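/- Let G be a finite group and M a Mackey functor over G. Then T(M), the levelwise additive (Grothendieck group) completion of sT(M), is a Tambara functor, and for every Tambara functor R the assignment F ↦ F ∘ θ_M is a bijection from Hom_{Tamb(G)}(T(M), R) to Hom_{Mack(G)}(M, R); that is, T(M) together with θ_M : M → T(M) is the free Tambara functor on M. -/

import Mathlib

set_option autoImplicit false

namespace Tamb

variable {G : Type} [Group G]

/-- A function between `G`-sets is equivariant. -/
def IsEquivariant (G : Type) [Group G] {A B : Type} [SMul G A] [SMul G B] (f : A → B) : Prop :=
  ∀ (g : G) (a : A), f (g • a) = g • f a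

section Maps

variable {X Y Z : Type} [MulAction G X] [MulAction G Y] [MulAction G Z]

/-- The identity equivariant map. -/
def gid (G X : Type) [Group G] [MulAction G X] : X →[G] X :=
  ⟨fun x => x, fun _ _ => rfl⟩

@[simp] theorem gid_apply (x : X) : gid G X x = x := rfl

/-- Composition of equivariant maps. -/
def gcomp (j : Y →[G] Z) (i : X →[G] Y) : X →[G] Z :=
  ⟨fun x => j (i x), fun g x => by
    show j (i (g • x)) = g • j (i x)
    rw [MulActionHom.map_smul, MulActionHom.map_smul]⟩

@[simp] theorem gcomp_apply (j : Y →[G] Z) (i : X →[G] Y) (x : X) : gcomp j i x = j (i x) := rfl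

/-- The pullback of two equivariant maps of `G`-sets. -/
def Pb (f : X →[G] Z) (g : Y →[G] Z) : Type := {p : X × Y // f p.1 = g p.2}

namespace Pb

variable (f : X →[G] Z) (g : Y →[G] Z)

instance : SMul G (Pb f g) :=
  ⟨fun a p => ⟨(a • p.1.1, a • p.1.2), by
    rw [MulActionHom.map_smul, MulActionHom.map_smul, p.2]⟩⟩

instance : MulAction G (Pb f g) where
  one_smul p := Subtype.ext (Prod.ext (one_smul _ _) (one_smul _ _))
  mul_smul a b p := Subtype.ext (Prod.ext (mul_smul _ _ _) (mul_smul _ _ _))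

instance [Finite X] [Finite Y] : Finite (Pb f g) := Subtype.finite

/-- First projection of a pullback. -/
def fstHom : Pb f g →[G] X := ⟨fun p => p.1.1, fun _ _ => rfl⟩
/-- Second projection of a pullback. -/
def sndHom : Pb f g →[G] Y := ⟨fun p => p.1.2, fun _ _ => rfl⟩

@[simp] theorem fstHom_apply (p : Pb f g) : fstHom f g p = p.1.1 := rfl
@[simp] theorem sndHom_apply (p : Pb f g) : sndHom f g p = p.1.2 := rfl

end Pb

/-- `Sec i j` is the set `∏_{i,j} X` of sections of `i : X → Y` defined on fibers
of `j : Y → Z`: an element is a point `z : Z` together with a section of `i`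
defined on `j⁻¹(z)`. -/
structure Sec (i : X →[G] Y) (j : Y →[G] Z) where
  pt : Z
  sec : ∀ y : Y, j y = pt → X
  isSec : ∀ (y : Y) (h : j y = pt), i (sec y h) = y

namespace Sec

variable {i : X →[G] Y} {j : Y →[G] Z}

theorem ext' {σ τ : Sec i j} (h1 : σ.pt = τ.pt)
    (h2 : ∀ (y : Y) (h : j y = σ.pt) (h' : j y = τ.pt), σ.sec y h = τ.sec y h') : σ = τ := by
  obtain ⟨p, s, hs⟩ := σ
  obtain ⟨p', s', hs'⟩ := τ
  dsimp at h1
  subst h1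
  have hss : s = s' := by
    funext y hy
    exact h2 y hy hy
  subst hss
  rfl

theorem sec_congr (σ : Sec i j) {y y' : Y} (e : y = y') {h : j y = σ.pt} {h' : j y' = σ.pt} :
    σ.sec y h = σ.sec y' h' := by subst e; rfl

instance : SMul G (Sec i j) :=
  ⟨fun a σ =>
    { pt := a • σ.pt
      sec := fun y h => a • σ.sec (a⁻¹ • y) (by rw [MulActionHom.map_smul, h, inv_smul_smul])
      isSec := fun y h => by
        rw [MulActionHom.map_smul, σ.isSec, smul_inv_smul] }⟩

@[simp] theorem smul_pt (a : G) (σ : Sec i j) : (a • σ).pt = a • σ.pt := rfl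

theorem smul_sec (a : G) (σ : Sec i j) (y : Y) (h : j y = (a • σ).pt)
    (h' : j (a⁻¹ • y) = σ.pt) : (a • σ).sec y h = a • σ.sec (a⁻¹ • y) h' := rfl

instance : MulAction G (Sec i j) where
  one_smul σ := by
    refine ext' (one_smul _ _) (fun y h h' => ?_)
    have h'' : j ((1 : G)⁻¹ • y) = σ.pt := by rw [inv_one, one_smul]; exact h'
    rw [smul_sec 1 σ y h h'', one_smul]
    exact sec_congr σ (by rw [inv_one, one_smul])
  mul_smul a b σ := by
    refine ext' (mul_smul _ _ _) (fun y h h' => ?_)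
    have h1 : j ((a * b)⁻¹ • y) = σ.pt := by
      rw [MulActionHom.map_smul, h]
      exact inv_smul_smul _ _
    have h2 : j (a⁻¹ • y) = (b • σ).pt := by
      rw [MulActionHom.map_smul, h']
      show a⁻¹ • (a • (b • σ).pt) = _
      exact inv_smul_smul _ _
    have h3 : j (b⁻¹ • (a⁻¹ • y)) = σ.pt := by
      rw [MulActionHom.map_smul, h2]
      exact inv_smul_smul _ _
    rw [smul_sec (a * b) σ y h h1, smul_sec a (b • σ) y h' h2, smul_sec b σ (a⁻¹ • y) h2 h3,
      mul_smul]
    exact congrArg (a • ·) (congrArg (b • ·) (sec_congr σ (by rw [mul_inv_rev, mul_smul])))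

instance optionFinite {X : Type} [Finite X] : Finite (Option X) :=
  Finite.of_equiv (X ⊕ PUnit.{1}) (Equiv.optionEquivSumPUnit.{0,0} X).symm

instance [Finite X] [Finite Y] [Finite Z] : Finite (Sec i j) := by
  classical
  have hF : Function.Injective (fun σ : Sec i j =>
      ((σ.pt, fun y => if h : j y = σ.pt then some (σ.sec y h) else none) :
        Z × (Y → Option X))) := by
    intro σ τ he
    have h1 : σ.pt = τ.pt := congrArg Prod.fst he
    refine ext' h1 (fun y hy hy' => ?_)
    have h2 := congrFun (congrArg Prod.snd he) y
    dsimp only at h2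
    rw [dif_pos hy, dif_pos hy'] at h2
    exact Option.some_injective _ h2
  exact Finite.of_injective _ hF

end Sec

/-- The canonical projection `∏_{i,j} X → Z`. -/
def pHom (i : X →[G] Y) (j : Y →[G] Z) : Sec i j →[G] Z :=
  ⟨fun σ => σ.pt, fun _ _ => rfl⟩

@[simp] theorem pHom_apply (i : X →[G] Y) (j : Y →[G] Z) (σ : Sec i j) :
    pHom i j σ = σ.pt := rfl

/-- The canonical pullback `Y ×_Z ∏_{i,j} X`. -/
abbrev ECan (i : X →[G] Y) (j : Y →[G] Z) : Type := Pb j (pHom i j)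

/-- The evaluation map `e : Y ×_Z ∏_{i,j} X → X`. -/
def eval (i : X →[G] Y) (j : Y →[G] Z) : ECan i j → X := fun q => q.1.2.sec q.1.1 q.2

theorem eval_smul (i : X →[G] Y) (j : Y →[G] Z) (a : G) (q : ECan i j) :
    eval i j (a • q) = a • eval i j q := by
  have h1 : j (a • q.1.1) = (a • q.1.2).pt := by
    rw [MulActionHom.map_smul, q.2]; rfl
  have h2 : j (a⁻¹ • (a • q.1.1)) = q.1.2.pt := by rw [inv_smul_smul]; exact q.2
  calc eval i j (a • q) = (a • q.1.2).sec (a • q.1.1) h1 := rfl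
    _ = a • q.1.2.sec (a⁻¹ • (a • q.1.1)) h2 := Sec.smul_sec _ _ _ _ _
    _ = a • q.1.2.sec q.1.1 q.2 := congrArg (a • ·) (Sec.sec_congr _ (inv_smul_smul a q.1.1))

/-- The evaluation map as an equivariant map. -/
def evalHom (i : X →[G] Y) (j : Y →[G] Z) : ECan i j →[G] X :=
  ⟨eval i j, eval_smul i j⟩

/-- The projection `π₂ : Y ×_Z ∏_{i,j} X → ∏_{i,j} X` of the canonical exponential diagram. -/
def pi2Hom (i : X →[G] Y) (j : Y →[G] Z) : ECan i j →[G] Sec i j :=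
  Pb.sndHom j (pHom i j)

end Maps

/-- `(f, g, h)` is a distributor for `(i, j)`: the diagram with bottom row
`X →i Y →j Z`, top row `g : A → B`, left vertical `f : A → X` and right vertical
`h : B → Z` is an exponential diagram, i.e. it is isomorphic (by equivariant
bijections fixing the bottom row) to the canonical diagram built from `∏_{i,j} X`. -/
def IsDistributor {X Y Z A B : Type} [MulAction G X] [MulAction G Y] [MulAction G Z]
    [MulAction G A] [MulAction G B]
    (i : X →[G] Y) (j : Y →[G] Z) (f : A →[G] X) (g : A →[G] B) (h : B →[G] Z) : Prop :=
  ∃ (α : A ≃ ECan i j) (β : B ≃ Sec i j),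
    IsEquivariant G ⇑α ∧ IsEquivariant G ⇑β ∧
    (∀ a, eval i j (α a) = f a) ∧
    (∀ a, β (g a) = (α a).1.2) ∧
    (∀ b, (β b).pt = h b)
section CoreB

/-- A (bundled) finite `G`-set. -/
structure FinGSet (G : Type) [Group G] : Type 1 where
  carrier : Type
  [fin : Finite carrier]
  [act : MulAction G carrier]

attribute [instance] FinGSet.fin FinGSet.act

instance : MulAction G Empty where
  smul _ e := e.elim
  one_smul e := e.elim
  mul_smul _ _ e := e.elim

/-- Bundle a finite `G`-set. -/
def mkG (G : Type) [Group G] (A : Type) [MulAction G A] [Finite A] : FinGSet G := ⟨A⟩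

/-- The empty `G`-set. -/
def emptyG (G : Type) [Group G] : FinGSet G := ⟨Empty⟩
/-- The one-point `G`-set (`G/G`). -/
def ptG (G : Type) [Group G] : FinGSet G := ⟨PUnit⟩
/-- Binary coproduct of finite `G`-sets. -/
def sumG (X Y : FinGSet G) : FinGSet G := ⟨X.carrier ⊕ Y.carrier⟩
/-- Binary product of finite `G`-sets. -/
def prodG (X Y : FinGSet G) : FinGSet G := ⟨X.carrier × Y.carrier⟩

def initHom (X : FinGSet G) : (emptyG G).carrier →[G] X.carrier :=
  ⟨fun e => e.elim, fun _ e => e.elim⟩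
def toPtHom (X : FinGSet G) : X.carrier →[G] (ptG G).carrier :=
  ⟨fun _ => PUnit.unit, fun _ _ => rfl⟩
def inlHom (X Y : FinGSet G) : X.carrier →[G] (sumG X Y).carrier :=
  ⟨Sum.inl, fun _ _ => rfl⟩
def inrHom (X Y : FinGSet G) : Y.carrier →[G] (sumG X Y).carrier :=
  ⟨Sum.inr, fun _ _ => rfl⟩
def sumMapHom {X Y X' Y' : FinGSet G} (f : X.carrier →[G] X'.carrier)
    (g : Y.carrier →[G] Y'.carrier) : (sumG X Y).carrier →[G] (sumG X' Y').carrier :=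
  ⟨Sum.map f g, fun a x => by
    cases x with
    | inl v => show Sum.inl (f (a • v)) = Sum.inl (a • f v); rw [MulActionHom.map_smul]
    | inr v => show Sum.inr (g (a • v)) = Sum.inr (a • g v); rw [MulActionHom.map_smul]⟩
def sumElimHom {X Y Z : FinGSet G} (f : X.carrier →[G] Z.carrier)
    (g : Y.carrier →[G] Z.carrier) : (sumG X Y).carrier →[G] Z.carrier :=
  ⟨Sum.elim f g, fun a x => by
    cases x with
    | inl v => show f (a • v) = a • f v; rw [MulActionHom.map_smul]
    | inr v => show g (a • v) = a • g v; rw [MulActionHom.map_smul]⟩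
/-- The fold map `X ⊔ X → X`. -/
def foldHom (X : FinGSet G) : (sumG X X).carrier →[G] X.carrier :=
  sumElimHom (gid G X.carrier) (gid G X.carrier)
def prodMapHom {X Y X' Y' : FinGSet G} (f : X.carrier →[G] X'.carrier)
    (g : Y.carrier →[G] Y'.carrier) : (prodG X Y).carrier →[G] (prodG X' Y').carrier :=
  ⟨Prod.map f g, fun a x => Prod.ext (MulActionHom.map_smul f a x.1) (MulActionHom.map_smul g a x.2)⟩
def pi1Hom (X Y : FinGSet G) : (prodG X Y).carrier →[G] X.carrier :=
  ⟨Prod.fst, fun _ _ => rfl⟩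
def pi2ProdHom (X Y : FinGSet G) : (prodG X Y).carrier →[G] Y.carrier :=
  ⟨Prod.snd, fun _ _ => rfl⟩

/-- A semi-Mackey functor over `G` (with set values): restrictions and transfers,
functorial, converting coproducts into products, and satisfying the pullback
(Mackey double coset) condition. -/
structure SemiMackey (G : Type) [Group G] : Type 2 where
  obj : FinGSet G → Type 1
  nonempty : ∀ X, Nonempty (obj X)
  res : ∀ {X Y : FinGSet G}, (X.carrier →[G] Y.carrier) → obj Y → obj X
  tr : ∀ {X Y : FinGSet G}, (X.carrier →[G] Y.carrier) → obj X → obj Y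
  res_id : ∀ {X : FinGSet G} (x : obj X), res (gid G X.carrier) x = x
  res_comp : ∀ {X Y Z : FinGSet G} (i : X.carrier →[G] Y.carrier)
    (j : Y.carrier →[G] Z.carrier) (z : obj Z), res i (res j z) = res (gcomp j i) z
  tr_id : ∀ {X : FinGSet G} (x : obj X), tr (gid G X.carrier) x = x
  tr_comp : ∀ {X Y Z : FinGSet G} (i : X.carrier →[G] Y.carrier)
    (j : Y.carrier →[G] Z.carrier) (x : obj X), tr j (tr i x) = tr (gcomp j i) x
  mackey : ∀ {X Y Z : FinGSet G} (j : X.carrier →[G] Z.carrier)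
    (i : Y.carrier →[G] Z.carrier) (y : obj Y),
    res j (tr i y) =
      tr (X := mkG G (Pb j i)) (Pb.fstHom j i) (res (X := mkG G (Pb j i)) (Pb.sndHom j i) y)
  sum_bij : ∀ (X Y : FinGSet G),
    Function.Bijective (fun z : obj (sumG X Y) => (res (inlHom X Y) z, res (inrHom X Y) z))
  empty_subsingleton : Subsingleton (obj (emptyG G))

/-- A semi-Tambara functor over `G`: a semi-Mackey functor with multiplicative
norms, commuting with restrictions over pullbacks and satisfying the
distributive law over exponential diagrams. -/
structure SemiTambara (G : Type) [Group G] extends SemiMackey G : Type 2 where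
  nm : ∀ {X Y : FinGSet G}, (X.carrier →[G] Y.carrier) → obj X → obj Y
  nm_id : ∀ {X : FinGSet G} (x : obj X), nm (gid G X.carrier) x = x
  nm_comp : ∀ {X Y Z : FinGSet G} (i : X.carrier →[G] Y.carrier)
    (j : Y.carrier →[G] Z.carrier) (x : obj X), nm j (nm i x) = nm (gcomp j i) x
  nm_res : ∀ {X Y Z : FinGSet G} (j : X.carrier →[G] Z.carrier)
    (i : Y.carrier →[G] Z.carrier) (y : obj Y),
    res j (nm i y) =
      nm (X := mkG G (Pb j i)) (Pb.fstHom j i) (res (X := mkG G (Pb j i)) (Pb.sndHom j i) y)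
  distrib : ∀ {X Y Z A B : FinGSet G} (i : X.carrier →[G] Y.carrier)
    (j : Y.carrier →[G] Z.carrier) (f : A.carrier →[G] X.carrier)
    (g : A.carrier →[G] B.carrier) (h : B.carrier →[G] Z.carrier),
    IsDistributor i j f g h → ∀ x : obj X, nm j (tr i x) = tr h (nm g (res f x))

/-- The element of `M(X ⊔ Y)` corresponding to a pair `(x, y)`. -/
noncomputable def SemiMackey.pairElt (M : SemiMackey G) {X Y : FinGSet G}
    (x : M.obj X) (y : M.obj Y) : M.obj (sumG X Y) :=
  (Equiv.ofBijective _ (M.sum_bij X Y)).symm (x, y)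

/-- The addition on `M(X)` induced by transfer along the fold map. -/
noncomputable def SemiMackey.add (M : SemiMackey G) {X : FinGSet G} (x y : M.obj X) : M.obj X :=
  M.tr (foldHom X) (M.pairElt x y)

/-- The zero of `M(X)`: the transfer of the unique element of `M(∅)`. -/
noncomputable def SemiMackey.zero (M : SemiMackey G) (X : FinGSet G) : M.obj X :=
  M.tr (initHom X) (M.nonempty (emptyG G)).some

/-- The multiplication on `R(X)` induced by the norm along the fold map. -/
noncomputable def SemiTambara.mul (R : SemiTambara G) {X : FinGSet G} (x y : R.obj X) :
    R.obj X :=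
  R.nm (foldHom X) (R.toSemiMackey.pairElt x y)

/-- The multiplicative unit of `R(X)`: the norm of the unique element of `R(∅)`. -/
noncomputable def SemiTambara.one (R : SemiTambara G) (X : FinGSet G) : R.obj X :=
  R.nm (initHom X) (R.nonempty (emptyG G)).some

/-- A Mackey functor: a semi-Mackey functor all of whose values are abelian
groups under the transfer-induced addition. -/
structure Mackey (G : Type) [Group G] extends SemiMackey G : Type 2 where
  hasNeg : ∀ (X : FinGSet G) (x : obj X), ∃ y, toSemiMackey.add x y = toSemiMackey.zero X

/-- A Tambara functor: a semi-Tambara functor all of whose values are abelian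
groups under the transfer-induced addition. -/
structure Tambara (G : Type) [Group G] extends SemiTambara G : Type 2 where
  hasNeg : ∀ (X : FinGSet G) (x : obj X),
    ∃ y, toSemiMackey.add x y = toSemiMackey.zero X

/-- A map of semi-Mackey functors. -/
structure SMackHom {G : Type} [Group G] (M N : SemiMackey G) : Type 1 where
  app : ∀ X, M.obj X → N.obj X
  app_res : ∀ {X Y : FinGSet G} (f : X.carrier →[G] Y.carrier) (y : M.obj Y),
    app X (M.res f y) = N.res f (app Y y)
  app_tr : ∀ {X Y : FinGSet G} (f : X.carrier →[G] Y.carrier) (x : M.obj X),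
    app Y (M.tr f x) = N.tr f (app X x)

/-- A map of semi-Tambara functors. -/
structure STambHom {G : Type} [Group G] (M N : SemiTambara G) extends
    SMackHom M.toSemiMackey N.toSemiMackey : Type 1 where
  app_nm : ∀ {X Y : FinGSet G} (f : X.carrier →[G] Y.carrier) (x : M.obj X),
    app Y (M.nm f x) = N.nm f (app X x)

/-- A formal "transfer of a norm of an element of `M`": a pair
`(U →i V →j X, u ∈ M(U))`. -/
structure PreT {G : Type} [Group G] (M : SemiMackey G) (X : FinGSet G) : Type 1 where
  U : FinGSet G
  V : FinGSet G
  i : U.carrier →[G] V.carrier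
  j : V.carrier →[G] X.carrier
  u : M.obj U

/-- Two pairs are isomorphic. -/
def IsoRel (M : SemiMackey G) (X : FinGSet G) (a b : PreT M X) : Prop :=
  ∃ (f : b.U.carrier ≃ a.U.carrier) (g : b.V.carrier ≃ a.V.carrier)
    (hf : IsEquivariant G ⇑f) (_ : IsEquivariant G ⇑g),
    (∀ u' : b.U.carrier, a.i (f u') = g (b.i u')) ∧
    (∀ v' : b.V.carrier, a.j (g v') = b.j v') ∧
    M.res (MulActionHom.mk ⇑f hf) a.u = b.u

/-- The relation defining the free semi-Tambara functor `sT(M)`: pairs are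
identified up to isomorphism and the distributive-law relation. -/
inductive STRel (M : SemiMackey G) (X : FinGSet G) : PreT M X → PreT M X → Prop
  | iso {a b : PreT M X} : IsoRel M X a b → STRel M X a b
  | distrib {W U V A B : FinGSet G} (k : W.carrier →[G] U.carrier)
      (i : U.carrier →[G] V.carrier) (j : V.carrier →[G] X.carrier)
      (f : A.carrier →[G] W.carrier) (g : A.carrier →[G] B.carrier)
      (h : B.carrier →[G] V.carrier) :
      IsDistributor k i f g h → ∀ w : M.obj W,
      STRel M X ⟨U, V, i, j, M.tr k w⟩ ⟨A, B, g, gcomp j h, M.res f w⟩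

/-- The value of the free semi-Tambara functor on `M` at `X`. -/
def sT (M : SemiMackey G) (X : FinGSet G) : Type 1 := Quot (STRel M X)

/-- The universal map `θ_M : M → sT(M)`, at the level of representatives. -/
def thetaPre (M : SemiMackey G) (X : FinGSet G) (x : M.obj X) : PreT M X :=
  ⟨X, X, gid G X.carrier, gid G X.carrier, x⟩

/-- Transfer on representatives: postcomposition. -/
def trPre (M : SemiMackey G) {X Y : FinGSet G} (f : X.carrier →[G] Y.carrier)
    (a : PreT M X) : PreT M Y :=
  ⟨a.U, a.V, a.i, gcomp f a.j, a.u⟩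

/-- Restriction on representatives: pull back both maps. -/
def resPre (M : SemiMackey G) {X Y : FinGSet G} (f : Y.carrier →[G] X.carrier)
    (a : PreT M X) : PreT M Y where
  U := mkG G (Pb a.i (Pb.fstHom a.j f))
  V := mkG G (Pb a.j f)
  i := Pb.sndHom a.i (Pb.fstHom a.j f)
  j := Pb.sndHom a.j f
  u := M.res (X := mkG G (Pb a.i (Pb.fstHom a.j f))) (Pb.fstHom a.i (Pb.fstHom a.j f)) a.u

/-- Norm on representatives, via the canonical exponential diagram for `(j, f)`. -/
def normPre (M : SemiMackey G) {X Y : FinGSet G} (f : X.carrier →[G] Y.carrier)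
    (a : PreT M X) : PreT M Y where
  U := mkG G (Pb a.i (evalHom a.j f))
  V := mkG G (Sec a.j f)
  i := gcomp (pi2Hom a.j f) (Pb.sndHom a.i (evalHom a.j f))
  j := pHom a.j f
  u := M.res (X := mkG G (Pb a.i (evalHom a.j f))) (Pb.fstHom a.i (evalHom a.j f)) a.u

/-- Addition on representatives: disjoint union. -/
noncomputable def addPre (M : SemiMackey G) {X : FinGSet G} (a b : PreT M X) : PreT M X where
  U := sumG a.U b.U
  V := sumG a.V b.V
  i := sumMapHom a.i b.i
  j := sumElimHom a.j b.j
  u := M.pairElt a.u b.u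

/-- A pair has (pure) degree `n` if every fiber of its first map has exactly `n`
elements. -/
def DegN {M : SemiMackey G} {X : FinGSet G} (n : ℕ) (a : PreT M X) : Prop :=
  ∀ v : a.V.carrier, Nat.card {u : a.U.carrier // a.i u = v} = n

/-- A finite `G`-set over `X` (a representative for the Burnside semi-Mackey functor). -/
structure BurnPre (G : Type) [Group G] (X : FinGSet G) : Type 1 where
  A : FinGSet G
  f : A.carrier →[G] X.carrier

/-- Isomorphism of finite `G`-sets over `X`. -/
def BurnIso {X : FinGSet G} (s t : BurnPre G X) : Prop :=
  ∃ (e : s.A.carrier ≃ t.A.carrier) (_ : IsEquivariant G ⇑e), ∀ x, t.f (e x) = s.f x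

/-- The pair `(∅ → A →f X, 0)` associated to a `G`-set over `X`. -/
noncomputable def bPair (M : SemiMackey G) {X : FinGSet G} (s : BurnPre G X) : PreT M X :=
  ⟨emptyG G, s.A, initHom s.A, s.f, (M.nonempty (emptyG G)).some⟩

end CoreB

section SetLevel

variable {X Y Z A B X' Y' Z' A' B' P Q V E : Type}

/-- A commutative square of functions which is a pullback, stated elementwise. -/
structure IsPB (p : P → X) (q : P → Y) (f : X → Z) (g : Y → Z) : Prop where
  comm : ∀ a, f (p a) = g (q a)
  ex : ∀ x y, f x = g y → ∃ a, p a = x ∧ q a = y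
  inj : ∀ a b, p a = p b → q a = q b → a = b

/-- Elementwise form of a distributor: sections of `i` over a fiber of `j` are described by
their images. -/
structure IsDist (i : X → Y) (j : Y → Z) (f : A → X) (g : A → B) (h : B → Z) : Prop where
  comm : ∀ a, j (i (f a)) = h (g a)
  ex : ∀ y b, j y = h b → ∃ a, i (f a) = y ∧ g a = b
  inj : ∀ a b, i (f a) = i (f b) → g a = g b → a = b
  sec_ex : ∀ (z : Z) (s : Set X), (∀ x ∈ s, j (i x) = z) → (∀ y, j y = z → ∃ x ∈ s, i x = y) →
    (∀ x ∈ s, ∀ x' ∈ s, i x = i x' → x = x') → ∃ b, h b = z ∧ ∀ a, g a = b → f a ∈ s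
  sec_inj : ∀ b b', h b = h b' →
    (∀ a a', g a = b → g a' = b' → i (f a) = i (f a') → f a = f a') → b = b'

namespace IsPB

theorem symm {p : P → X} {q : P → Y} {f : X → Z} {g : Y → Z} (h : IsPB p q f g) :
    IsPB q p g f :=
  ⟨fun a => (h.comm a).symm, fun x y e => by
    obtain ⟨a, h1, h2⟩ := h.ex y x e.symm
    exact ⟨a, h2, h1⟩, fun a b e e' => h.inj a b e' e⟩

/-- Pasting of pullback squares. -/
theorem paste {p : P → X} {q : P → Y} {f : X → Z} {g : Y → Z} (h : IsPB p q f g)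
    {r : Q → P} {t : Q → V} {k : V → Y} (h' : IsPB r t q k) :
    IsPB (fun x => p (r x)) t f (fun x => g (k x)) where
  comm a := by rw [h.comm, h'.comm]
  ex x v e := by
    obtain ⟨a, h1, h2⟩ := h.ex x (k v) e
    obtain ⟨b, h3, h4⟩ := h'.ex a v h2
    exact ⟨b, by rw [h3, h1], h4⟩
  inj a b e e' := h'.inj a b (h.inj _ _ e (by rw [h'.comm, h'.comm, e'])) e'

/-- Cancellation of pullback squares. -/
theorem cancel {p : P → X} {q : P → Y} {f : X → Z} {g : Y → Z} (h : IsPB p q f g)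
    {r : Q → P} {t : Q → V} {k : V → Y} (h' : IsPB (fun x => p (r x)) t f (fun x => g (k x)))
    (hc : ∀ x, q (r x) = k (t x)) :
    IsPB r t q k where
  comm := hc
  ex x v e := by
    obtain ⟨a, h1, h2⟩ := h'.ex (p x) v (by rw [h.comm, e])
    refine ⟨a, h.inj _ _ h1 ?_, h2⟩
    rw [hc, h2, e]
  inj a b e e' := h'.inj a b (by rw [e]) e'

theorem id_left (f : X → Y) : IsPB (fun x : X => x) f f (fun y : Y => y) :=
  ⟨fun _ => rfl, fun x y e => ⟨x, rfl, e⟩, fun _ _ e _ => e⟩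

end IsPB

namespace IsDist

theorem isPB {i : X → Y} {j : Y → Z} {f : A → X} {g : A → B} {h : B → Z}
    (D : IsDist i j f g h) : IsPB (fun a => i (f a)) g j h :=
  ⟨D.comm, D.ex, D.inj⟩

/-- Distributors for a composite of norms. -/
theorem comp_norm {j : V → X} {f : X → Y} {a : E → V} {h : E → B} {k : B → Y}
    (D : IsDist j f a h k) {f' : Y → Y'} {a' : A' → B} {h' : A' → B'} {k' : B' → Y'}
    (D' : IsDist k f' a' h' k') {p : P → E} {q : P → A'} (H : IsPB p q h a') :
    IsDist j (fun x => f' (f x)) (fun x => a (p x)) (fun x => h' (q x)) k' where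
  comm x := by rw [D.comm, H.comm, D'.comm]
  ex x b e := by
    obtain ⟨e', h1, h2⟩ := D'.ex (f x) b e
    obtain ⟨e1, h3, h4⟩ := D.ex x (a' e') h1.symm
    obtain ⟨e2, h5, h6⟩ := H.ex e1 e' h4
    exact ⟨e2, by rw [h5, h3], by rw [h6, h2]⟩
  inj x y e e' := by
    have h1 : q x = q y := D'.inj _ _ (by rw [← H.comm, ← H.comm, ← D.comm, ← D.comm, e]) e'
    exact H.inj _ _ (D.inj _ _ e (by rw [H.comm, H.comm, h1])) h1
  sec_ex y' s h1 h2 h3 := by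
    obtain ⟨b', hb, hb'⟩ := D'.sec_ex y' {b | f' (k b) = y' ∧ ∀ e, h e = b → a e ∈ s}
      (fun b hb => hb.1)
      (fun y hy => by
        obtain ⟨b, hb, hb'⟩ := D.sec_ex y {v | v ∈ s ∧ f (j v) = y} (fun v hv => hv.2)
          (fun x hx => by
            obtain ⟨v, hv, hv'⟩ := h2 x (by rw [hx, hy])
            exact ⟨v, ⟨hv, by rw [hv', hx]⟩, hv'⟩)
          (fun x hx x' hx' => h3 x hx.1 x' hx'.1)
        exact ⟨b, ⟨by rw [hb, hy], fun e he => (hb' e he).1⟩, hb⟩)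
      (fun b hb b' hb' hk => D.sec_inj _ _ hk
        (fun e e' he he' hj => h3 _ (hb.2 e he) _ (hb'.2 e' he') hj))
    exact ⟨b', hb, fun x hx => (hb' (q x) hx).2 _ (H.comm x)⟩
  sec_inj b b' hb H' := D'.sec_inj _ _ hb (fun x x' hx hx' hk => D.sec_inj _ _ hk
    (fun e e' he he' hj => by
      obtain ⟨y, hy, hy'⟩ := H.ex e x he
      obtain ⟨z, hz, hz'⟩ := H.ex e' x' he'
      have := H' y z (by rw [hy', hx]) (by rw [hz', hx']) (by rw [hy, hz, hj])
      rwa [hy, hz] at this))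

/-- Distributors for a composite of transfers. -/
theorem comp_tr {i : X → Y} {j : Y → Z} {f : A → X} {g : A → B} {h : B → Z}
    (D : IsDist i j f g h) {v : V → X} {p : P → V} {q : P → A} (H : IsPB p q v f)
    {a : E → P} {h1 : E → B'} {k1 : B' → B} (D' : IsDist q g a h1 k1) :
    IsDist (fun x => i (v x)) j (fun x => p (a x)) h1 (fun x => h (k1 x)) where
  comm x := by rw [H.comm, D.comm, D'.comm]
  ex y b e := by
    obtain ⟨x, h1, h2⟩ := D.ex y _ e
    obtain ⟨x', h3, h4⟩ := D'.ex x b h2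
    exact ⟨x', by rw [H.comm, h3, h1], h4⟩
  inj x y e e' := by
    rw [H.comm, H.comm] at e
    have := D.inj _ _ e (by rw [D'.comm, D'.comm, e'])
    exact D'.inj _ _ this e'
  sec_ex z s h1 h2 h3 := by
    obtain ⟨b, hb, hb'⟩ := D.sec_ex z (v '' s) (by rintro _ ⟨w, hw, rfl⟩; exact h1 w hw)
      (fun y hy => by
        obtain ⟨w, hw, hw'⟩ := h2 y hy
        exact ⟨v w, ⟨w, hw, rfl⟩, hw'⟩)
      (by
        rintro _ ⟨w, hw, rfl⟩ _ ⟨w', hw', rfl⟩ e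
        rw [h3 w hw w' hw' e])
    obtain ⟨b', hc, hc'⟩ := D'.sec_ex b {x | p x ∈ s ∧ g (q x) = b} (fun x hx => hx.2)
      (fun x hx => by
        obtain ⟨w, hw, hw'⟩ := hb' x hx
        obtain ⟨x', h4, h5⟩ := H.ex w x hw'
        exact ⟨x', ⟨by rwa [h4], by rw [h5, hx]⟩, h5⟩)
      (fun x hx x' hx' e => H.inj _ _
        (h3 _ hx.1 _ hx'.1 (by rw [H.comm, H.comm, e])) e)
    exact ⟨b', by rw [hc, hb], fun x hx => (hc' x hx).1⟩
  sec_inj b b' hb H' := by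
    have key : ∀ x x', h1 x = b → h1 x' = b' → i (f (q (a x))) = i (f (q (a x'))) →
        p (a x) = p (a x') := fun x x' hx hx' e =>
      H' x x' hx hx' (by rw [H.comm, H.comm, e])
    have hk : k1 b = k1 b' := D.sec_inj _ _ hb (fun y y' hy hy' e => by
      obtain ⟨x, h2, h3⟩ := D'.ex y b hy
      obtain ⟨x', h4, h5⟩ := D'.ex y' b' hy'
      have := key x x' h3 h5 (by rw [h2, h4, e])
      rw [← h2, ← h4, ← H.comm, ← H.comm, this])
    refine D'.sec_inj _ _ hk (fun x x' hx hx' e => H.inj _ _ (key x x' hx hx' (by rw [e])) e)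

/-- Base change of distributors. -/
theorem base_change {i : X → Y} {j : Y → Z} {f : A → X} {g : A → B} {h : B → Z}
    (D : IsDist i j f g h) {cX : X' → X} {cY : Y' → Y} {cZ : Z' → Z} {cA : A' → A} {cB : B' → B}
    {i' : X' → Y'} {j' : Y' → Z'} {f' : A' → X'} {g' : A' → B'} {h' : B' → Z'}
    (HY : IsPB cY j' j cZ) (HX : IsPB cX i' i cY) (HB : IsPB cB h' h cZ) (HA : IsPB cA g' g cB)
    (hf : ∀ a, cX (f' a) = f (cA a)) (hc : ∀ a, j' (i' (f' a)) = h' (g' a)) :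
    IsDist i' j' f' g' h' where
  comm := hc
  ex y b e := by
    obtain ⟨a, h1, h2⟩ := D.ex (cY y) (cB b) (by rw [HY.comm, HB.comm, e])
    obtain ⟨a', h3, h4⟩ := HA.ex a b h2
    exact ⟨a', HY.inj _ _ (by rw [← HX.comm, hf, h3, h1]) (by rw [hc, h4, e]), h4⟩
  inj a b e e' := by
    refine HA.inj _ _ (D.inj _ _ ?_ (by rw [HA.comm, HA.comm, e'])) e'
    rw [← hf, ← hf, HX.comm, HX.comm, e]
  sec_ex z s h1 h2 h3 := by
    obtain ⟨b, hb, hb'⟩ := D.sec_ex (cZ z) (cX '' s)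
      (by
        rintro _ ⟨x, hx, rfl⟩
        rw [HX.comm, HY.comm, h1 x hx])
      (fun y hy => by
        obtain ⟨y', h4, h5⟩ := HY.ex y z hy
        obtain ⟨x, hx, hx'⟩ := h2 y' h5
        exact ⟨_, ⟨x, hx, rfl⟩, by rw [HX.comm, hx', h4]⟩)
      (by
        rintro _ ⟨x, hx, rfl⟩ _ ⟨x', hx', rfl⟩ e
        rw [HX.comm, HX.comm] at e
        rw [h3 x hx x' hx' (HY.inj _ _ e (by rw [h1 x hx, h1 x' hx']))])
    obtain ⟨b', h4, h5⟩ := HB.ex b z hb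
    refine ⟨b', h5, fun a ha => ?_⟩
    obtain ⟨x, hx, hx'⟩ := hb' (cA a) (by rw [HA.comm, ha, h4])
    have : f' a = x := by
      refine HX.inj _ _ (by rw [hf, hx']) (HY.inj _ _ ?_ (by rw [hc, ha, h5, h1 x hx]))
      rw [← HX.comm, ← HX.comm, hf, hx']
    rwa [this]
  sec_inj b b' hb H' := by
    refine HB.inj _ _ (D.sec_inj _ _ (by rw [HB.comm, HB.comm, hb]) ?_) hb
    intro a a' ha ha' e
    obtain ⟨x, h1, h2⟩ := HA.ex a b ha
    obtain ⟨x', h3, h4⟩ := HA.ex a' b' ha'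
    have := H' x x' h2 h4 (HY.inj _ _ (by rw [← HX.comm, ← HX.comm, hf, hf, h1, h3, e])
      (by rw [hc, hc, h2, h4, hb]))
    rw [← h1, ← h3, ← hf, ← hf, this]

theorem sum_map {i : X → Y} {j : Y → Z} {f : A → X} {g : A → B} {h : B → Z}
    (D : IsDist i j f g h) {i' : X' → Y'} {j' : Y' → Z'} {f' : A' → X'} {g' : A' → B'}
    {h' : B' → Z'} (D' : IsDist i' j' f' g' h') :
    IsDist (Sum.map i i') (Sum.map j j') (Sum.map f f') (Sum.map g g') (Sum.map h h') where
  comm := by rintro (a | a) <;> simp [D.comm, D'.comm]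
  ex := by
    rintro (y | y) (b | b) e <;> simp at e
    · obtain ⟨a, h1, h2⟩ := D.ex y b e
      exact ⟨Sum.inl a, by simp [h1], by simp [h2]⟩
    · obtain ⟨a, h1, h2⟩ := D'.ex y b e
      exact ⟨Sum.inr a, by simp [h1], by simp [h2]⟩
  inj := by
    rintro (a | a) (b | b) e e' <;> simp at e e'
    · rw [D.inj a b e e']
    · rw [D'.inj a b e e']
  sec_ex := by
    rintro (z | z) s h1 h2 h3
    · obtain ⟨b, hb, hb'⟩ := D.sec_ex z {x | Sum.inl x ∈ s}
        (fun x hx => by simpa using h1 _ hx)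
        (fun y hy => by
          obtain ⟨x | x, hx, hx'⟩ := h2 (Sum.inl y) (by simp [hy])
          · exact ⟨x, hx, by simpa using hx'⟩
          · simp at hx')
        (fun x hx x' hx' e => by simpa using h3 _ hx _ hx' (by simp [e]))
      refine ⟨Sum.inl b, by simp [hb], ?_⟩
      rintro (a | a) ha
      · exact hb' a (by simpa using ha)
      · simp at ha
    · obtain ⟨b, hb, hb'⟩ := D'.sec_ex z {x | Sum.inr x ∈ s}
        (fun x hx => by simpa using h1 _ hx)
        (fun y hy => by
          obtain ⟨x | x, hx, hx'⟩ := h2 (Sum.inr y) (by simp [hy])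
          · simp at hx'
          · exact ⟨x, hx, by simpa using hx'⟩)
        (fun x hx x' hx' e => by simpa using h3 _ hx _ hx' (by simp [e]))
      refine ⟨Sum.inr b, by simp [hb], ?_⟩
      rintro (a | a) ha
      · simp at ha
      · exact hb' a (by simpa using ha)
  sec_inj := by
    rintro (b | b) (b' | b') hb H' <;> simp at hb
    · rw [D.sec_inj b b' hb (fun a a' h1 h2 e => by
        simpa using H' (Sum.inl a) (Sum.inl a') (by simp [h1]) (by simp [h2]) (by simp [e]))]
    · rw [D'.sec_inj b b' hb (fun a a' h1 h2 e => by
        simpa using H' (Sum.inr a) (Sum.inr a') (by simp [h1]) (by simp [h2]) (by simp [e]))]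

/-- The trivial distributor for an identity transfer. -/
theorem id_tr (j : Y → Z) :
    IsDist (fun y : Y => y) j (fun y : Y => y) j (fun z : Z => z) where
  comm _ := rfl
  ex y b e := ⟨y, rfl, e⟩
  inj _ _ e _ := e
  sec_ex z s h1 h2 h3 := ⟨z, rfl, fun y hy => by
    obtain ⟨x, hx, rfl⟩ := h2 y hy
    exact hx⟩
  sec_inj _ _ e _ := e

/-- The trivial distributor for an identity norm. -/
theorem id_norm (i : X → Y) :
    IsDist i (fun y : Y => y) (fun x : X => x) (fun x : X => x) i where
  comm _ := rfl
  ex y b e := ⟨b, e.symm, rfl⟩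
  inj _ _ _ e := e
  sec_ex z s h1 h2 h3 := by
    obtain ⟨x, hx, hx'⟩ := h2 z rfl
    exact ⟨x, hx', fun a ha => by rwa [ha]⟩
  sec_inj b b' e H := H b b' rfl rfl e

end IsDist

variable {U W B₁ B₂ A₂ E₂ W' : Type}

/-- The distributor for a norm applied to a distributor: the comparison of two ways of
distributing a norm over a transfer of a norm of a transfer. -/
theorem IsDist.distrib_norm {k : W → U} {i : U → V} {f : A → W} {g : A → B} {h : B → V}
    (D : IsDist k i f g h) {j : V → X} {φ : X → Y} {a : E → V} {h₁ : E → B₁} {k₁ : B₁ → Y}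
    (D₁ : IsDist j φ a h₁ k₁) {pU : P → U} {pE : P → E} (HP : IsPB pU pE i a)
    {w : W' → W} {k' : W' → P} (HW : IsPB w k' k pU)
    {f₂ : A₂ → W'} {g₂ : A₂ → B₂} {h₂ : B₂ → B₁}
    (D₂ : IsDist k' (fun x => h₁ (pE x)) f₂ g₂ h₂)
    {e₁ : E₂ → E} {e₂ : E₂ → B₂} (HE : IsPB e₁ e₂ h₁ h₂) {a₂ : E₂ → B}
    (ha₂ : ∀ x, h (a₂ x) = a (e₁ x))
    (link : ∀ x t, g₂ t = e₂ x → pE (k' (f₂ t)) = e₁ x → ∀ a', g a' = a₂ x →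
      k (f a') = pU (k' (f₂ t)) → f a' = w (f₂ t)) :
    IsDist (fun x => j (h x)) φ a₂ e₂ (fun x => k₁ (h₂ x)) where
  comm x := by rw [ha₂, D₁.comm, HE.comm]
  ex x b e := by
    obtain ⟨e', h3, h4⟩ := D₁.ex x _ e
    obtain ⟨y, h5, h6⟩ := HE.ex e' b h4
    exact ⟨y, by rw [ha₂, h5, h3], h6⟩
  inj x y e e' := by
    rw [ha₂, ha₂] at e
    exact HE.inj _ _ (D₁.inj _ _ e (by rw [HE.comm, HE.comm, e'])) e'
  sec_ex y s h3 h4 h5 := by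
    obtain ⟨b₁, hb₁, hb₁'⟩ := D₁.sec_ex y (h '' s) (by rintro _ ⟨b, hb, rfl⟩; exact h3 b hb)
      (fun x hx => by
        obtain ⟨b, hb, hb'⟩ := h4 x hx
        exact ⟨_, ⟨b, hb, rfl⟩, hb'⟩)
      (by
        rintro _ ⟨b, hb, rfl⟩ _ ⟨b', hb', rfl⟩ e
        rw [h5 b hb b' hb' e])
    have huniq : ∀ b ∈ s, ∀ b' ∈ s, h b = h b' → b = b' :=
      fun b hb b' hb' e => h5 b hb b' hb' (by rw [e])
    obtain ⟨b₂, hb₂, hb₂'⟩ := D₂.sec_ex b₁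
      {x | h₁ (pE (k' x)) = b₁ ∧ ∃ a₀, g a₀ ∈ s ∧ h (g a₀) = a (pE (k' x)) ∧ f a₀ = w x}
      (fun x hx => hx.1)
      (fun p hp => by
        obtain ⟨b, hb, hb'⟩ := hb₁' (pE p) hp
        obtain ⟨a₀, h6, h7⟩ := D.ex (pU p) b (by rw [HP.comm, hb'])
        obtain ⟨x, h8, h9⟩ := HW.ex (f a₀) p h6
        refine ⟨x, ⟨by rw [h9, hp], a₀, by rwa [h7], by rw [h7, h9, hb'], h8.symm⟩, h9⟩)
      (by
        rintro x ⟨-, a₀, h6, h7, h8⟩ x' ⟨-, a₀', h6', h7', h8'⟩ e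
        refine HW.inj _ _ ?_ e
        rw [← h8, ← h8']
        rw [D.inj a₀ a₀' (by rw [h8, h8', HW.comm, HW.comm, e])
          (huniq _ h6 _ h6' (by rw [h7, h7', e]))])
    refine ⟨b₂, by rw [hb₂, hb₁], fun x hx => ?_⟩
    obtain ⟨b, hb, hb'⟩ := hb₁' (e₁ x) (by rw [HE.comm, hx, hb₂])
    rw [D.sec_inj (a₂ x) b (by rw [ha₂, hb']) ?_]
    · exact hb
    intro a₀ a₀' h6 h7 e
    obtain ⟨p, h8, h9⟩ := HP.ex (k (f a₀)) (e₁ x) (by rw [D.comm, h6, ha₂])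
    obtain ⟨t, h10, h11⟩ := D₂.ex p b₂ (by rw [h9, HE.comm, hx])
    obtain ⟨-, a₁, h12, h13, h14⟩ := hb₂' t h11
    have h15 : g a₁ = b := huniq _ h12 _ hb (by rw [h13, h10, h9, hb'])
    rw [link x t (by rw [h11, hx]) (by rw [h10, h9]) a₀ h6 (by rw [h10, h8]), ← h14]
    rw [D.inj a₁ a₀' (by rw [h14, HW.comm, h10, h8, e]) (by rw [h15, h7])]
  sec_inj b b' hb H := by
    have h3 : h₂ b = h₂ b' := D₁.sec_inj _ _ hb (fun e e' he he' hj => by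
      obtain ⟨x, h4, h5⟩ := HE.ex e b he
      obtain ⟨x', h6, h7⟩ := HE.ex e' b' he'
      have := H x x' h5 h7 (by rw [ha₂, ha₂, h4, h6, hj])
      rw [← h4, ← h6, ← ha₂, ← ha₂, this])
    refine D₂.sec_inj _ _ h3 (fun t t' ht ht' e => HW.inj _ _ ?_ e)
    obtain ⟨x, h4, h5⟩ := HE.ex (pE (k' (f₂ t))) b (by rw [D₂.comm, ht])
    obtain ⟨x', h6, h7⟩ := HE.ex (pE (k' (f₂ t'))) b' (by rw [D₂.comm, ht'])
    have h8 : a₂ x = a₂ x' := H x x' h5 h7 (by rw [ha₂, ha₂, h4, h6, e])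
    obtain ⟨a₀, h9, h10⟩ := D.ex (pU (k' (f₂ t))) (a₂ x) (by rw [HP.comm, ha₂, h4])
    rw [← link x t (by rw [ht, h5]) h4.symm a₀ h10 h9,
      ← link x' t' (by rw [ht', h7]) h6.symm a₀ (by rw [h10, h8]) (by rw [h9, e])]

theorem IsDist.distrib_norm_isPB {k : W → U} {i : U → V} {f : A → W} {g : A → B} {h : B → V}
    (D : IsDist k i f g h) {a : E → V} {h₁ : E → B₁}
    {pU : P → U} {pE : P → E} (HP : IsPB pU pE i a)
    {w : W' → W} {k' : W' → P} (HW : IsPB w k' k pU)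
    {f₂ : A₂ → W'} {g₂ : A₂ → B₂} {h₂ : B₂ → B₁}
    (D₂ : IsDist k' (fun x => h₁ (pE x)) f₂ g₂ h₂)
    {e₁ : E₂ → E} {e₂ : E₂ → B₂} (HE : IsPB e₁ e₂ h₁ h₂) {a₂ : E₂ → B}
    (ha₂ : ∀ x, h (a₂ x) = a (e₁ x))
    {m : A₂ → E₂} {n : A₂ → A} (hm₁ : ∀ t, e₁ (m t) = pE (k' (f₂ t)))
    (hm₂ : ∀ t, e₂ (m t) = g₂ t) (hn₁ : ∀ t, g (n t) = a₂ (m t))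
    (hn₂ : ∀ t, f (n t) = w (f₂ t)) :
    IsPB n m g a₂ where
  comm := hn₁
  ex x y e := by
    obtain ⟨p, h1, h2⟩ := HP.ex (k (f x)) (e₁ y) (by rw [D.comm, e, ha₂])
    obtain ⟨t, h3, h4⟩ := D₂.ex p (e₂ y) (by rw [h2, HE.comm])
    have h5 : m t = y := HE.inj _ _ (by rw [hm₁, h3, h2]) (by rw [hm₂, h4])
    exact ⟨t, D.inj _ _ (by rw [hn₂, HW.comm, h3, h1]) (by rw [hn₁, h5, e]), h5⟩
  inj t t' e e' := by
    refine D₂.inj _ _ (HP.inj _ _ ?_ ?_) (by rw [← hm₂, ← hm₂, e'])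
    · rw [← HW.comm, ← HW.comm, ← hn₂, ← hn₂, e]
    · rw [← hm₁, ← hm₁, e']

end SetLevel

/-- Equivariant maps between bundled finite `G`-sets. -/
abbrev Hom (X Y : FinGSet G) : Type := X.carrier →[G] Y.carrier

theorem Hom.ext {X Y : FinGSet G} {f g : Hom X Y} (h : ∀ x, f x = g x) : f = g :=
  MulActionHom.ext h

theorem exists_isPB {X Y Z : FinGSet G} (f : Hom X Z) (g : Hom Y Z) :
    ∃ (P : FinGSet G) (p : Hom P X) (q : Hom P Y), IsPB p q f g :=
  ⟨mkG G (Pb f g), Pb.fstHom f g, Pb.sndHom f g, fun a => a.2, fun x y e => ⟨⟨(x, y), e⟩, rfl, rfl⟩,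
    fun _ _ e e' => Subtype.ext (Prod.ext e e')⟩

theorem isPB_canonical {X Y Z : FinGSet G} (f : Hom X Z) (g : Hom Y Z) :
    IsPB (Pb.fstHom f g) (Pb.sndHom f g) f g :=
  ⟨fun a => a.2, fun x y e => ⟨⟨(x, y), e⟩, rfl, rfl⟩,
    fun _ _ e e' => Subtype.ext (Prod.ext e e')⟩

theorem IsPB.lift {X Y Z P T : FinGSet G} {p : Hom P X} {q : Hom P Y} {f : Hom X Z}
    {g : Hom Y Z} (H : IsPB p q f g) (a : Hom T X) (b : Hom T Y) (h : ∀ t, f (a t) = g (b t)) :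
    ∃ l : Hom T P, (∀ t, p (l t) = a t) ∧ ∀ t, q (l t) = b t := by
  choose l h1 h2 using fun t => H.ex (a t) (b t) (h t)
  refine ⟨⟨l, fun c t => H.inj _ _ ?_ ?_⟩, h1, h2⟩
  · rw [h1, map_smul, map_smul, h1]; rfl
  · rw [h2, map_smul, map_smul, h2]; rfl

theorem IsPB.exists_iso {X Y Z P P' : FinGSet G} {p : Hom P X} {q : Hom P Y} {f : Hom X Z}
    {g : Hom Y Z} (H : IsPB p q f g) {p' : Hom P' X} {q' : Hom P' Y} (H' : IsPB p' q' f g) :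
    ∃ l : Hom P' P, Function.Bijective l ∧ (∀ t, p (l t) = p' t) ∧ ∀ t, q (l t) = q' t := by
  obtain ⟨l, h1, h2⟩ := H.lift p' q' H'.comm
  refine ⟨l, ⟨fun a b e => H'.inj _ _ ?_ ?_, fun x => ?_⟩, h1, h2⟩
  · rw [← h1, ← h1, e]
  · rw [← h2, ← h2, e]
  · obtain ⟨y, h3, h4⟩ := H'.ex (p x) (q x) (H.comm x)
    exact ⟨y, H.inj _ _ (by rw [h1, h3]) (by rw [h2, h4])⟩

theorem exists_inverse {X Y : FinGSet G} (f : Hom X Y) (hf : Function.Bijective f) :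
    ∃ e : Hom Y X, Function.Bijective e ∧ (∀ x, e (f x) = x) ∧ ∀ y, f (e y) = y := by
  obtain ⟨e, h1, h2⟩ := Function.bijective_iff_has_inverse.1 hf
  refine ⟨⟨e, fun c y => hf.1 ?_⟩, Function.bijective_iff_has_inverse.2 ⟨f, h2, h1⟩, h1, h2⟩
  rw [h2, map_smul, h2]; rfl

theorem isDist_canonical {X Y Z : FinGSet G} (i : Hom X Y) (j : Hom Y Z) :
    IsDist i j (evalHom i j) (pi2Hom i j) (pHom i j) where
  comm a := (congrArg j (a.1.2.isSec _ _)).trans a.2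
  ex y b e := ⟨⟨(y, b), e⟩, b.isSec _ _, rfl⟩
  inj a b e e' := by
    have h1 : i (eval i j a) = a.1.1 := a.1.2.isSec _ _
    have h2 : i (eval i j b) = b.1.1 := b.1.2.isSec _ _
    exact Subtype.ext (Prod.ext (h1.symm.trans (e.trans h2)) e')
  sec_ex z s h1 h2 h3 := by
    choose t ht ht' using h2
    refine ⟨⟨z, t, ht'⟩, rfl, ?_⟩
    rintro ⟨⟨y, b⟩, e⟩ rfl
    exact ht y e
  sec_inj b b' hb H := Sec.ext' hb fun y h h' =>
    H ⟨(y, b), h⟩ ⟨(y, b'), h'⟩ rfl rfl ((b.isSec _ _).trans (b'.isSec _ _).symm)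

theorem exists_isDist {X Y Z : FinGSet G} (i : Hom X Y) (j : Hom Y Z) :
    ∃ (A B : FinGSet G) (f : Hom A X) (g : Hom A B) (h : Hom B Z), IsDist i j f g h :=
  ⟨mkG G (ECan i j), mkG G (Sec i j), evalHom i j, pi2Hom i j, pHom i j, isDist_canonical i j⟩

/-- The universal property of a distributor. -/
theorem IsDist.lift {X Y Z A B T Q : FinGSet G} {i : Hom X Y} {j : Hom Y Z} {f : Hom A X}
    {g : Hom A B} {h : Hom B Z} (D : IsDist i j f g h) {y : Hom Q Y} {t : Hom Q T}
    {c : Hom T Z} (H : IsPB y t j c) (e : Hom Q X) (he : ∀ q, i (e q) = y q) :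
    ∃ l : Hom T B, (∀ x, h (l x) = c x) ∧
      ∀ a q, g a = l (t q) → i (f a) = y q → f a = e q := by
  choose l h1 h2 using fun x => D.sec_ex (c x) {v | ∃ q, t q = x ∧ e q = v}
    (by rintro _ ⟨q, rfl, rfl⟩; rw [he, H.comm])
    (fun z hz => by
      obtain ⟨q, h1, h2⟩ := H.ex z x hz
      exact ⟨_, ⟨q, h2, rfl⟩, by rw [he, h1]⟩)
    (by
      rintro _ ⟨q, rfl, rfl⟩ _ ⟨q', hq, rfl⟩ hh
      rw [he, he] at hh
      rw [H.inj q q' hh hq.symm])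
  have key : ∀ a q, g a = l (t q) → i (f a) = y q → f a = e q := by
    intro a q ha ha'
    obtain ⟨q', h3, h4⟩ := h2 _ a ha
    rw [← h4]
    rw [H.inj q' q (by rw [← he, h4, ha']) h3]
  refine ⟨⟨l, fun r x => D.sec_inj _ _ ?_ ?_⟩, h1, key⟩
  · rw [h1, map_smul, map_smul, h1]; rfl
  · intro a a' ha ha' hi
    obtain ⟨q, h3, h4⟩ := H.ex (i (f a)) (r • x) (by rw [D.comm, ha, h1])
    rw [key a q (by rw [ha, h4]) h3.symm]
    have h5 : g (r⁻¹ • a') = l x := by rw [map_smul, ha']; exact inv_smul_smul _ _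
    have h6 := key (r⁻¹ • a') (r⁻¹ • q) (by rw [h5, map_smul, h4]; simp)
      (by rw [map_smul, map_smul, map_smul, ← hi, h3])
    rw [map_smul, map_smul] at h6
    simpa using h6.symm

theorem IsDist.exists_iso {X Y Z A B A' B' : FinGSet G} {i : Hom X Y} {j : Hom Y Z}
    {f : Hom A X} {g : Hom A B} {h : Hom B Z} (D : IsDist i j f g h)
    {f' : Hom A' X} {g' : Hom A' B'} {h' : Hom B' Z} (D' : IsDist i j f' g' h') :
    ∃ (l : Hom A' A) (m : Hom B' B), Function.Bijective l ∧ Function.Bijective m ∧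
      (∀ a, f (l a) = f' a) ∧ (∀ a, g (l a) = m (g' a)) ∧ ∀ b, h (m b) = h' b := by
  obtain ⟨m, h1, h2⟩ := D.lift (y := gcomp i f') D'.isPB f' (fun _ => rfl)
  have HA : IsPB (gcomp i f) g j h := D.isPB
  obtain ⟨l, h3, h4⟩ := HA.lift (gcomp i f') (gcomp m g') (fun a => by
    simp only [gcomp_apply]; rw [h1, D'.comm])
  simp only [gcomp_apply] at h3 h4
  have hf : ∀ a, f (l a) = f' a := fun a => h2 _ _ (h4 a) (h3 a)
  have hm : Function.Bijective m := by
    constructor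
    · intro b b' e
      refine D'.sec_inj _ _ (by rw [← h1, ← h1, e]) (fun a a' ha ha' hi => ?_)
      rw [← hf, ← hf] at hi ⊢
      rw [D.inj _ _ hi (by rw [h4, h4, ha, ha', e])]
    · intro b
      obtain ⟨b', h5, h6⟩ := D'.sec_ex (h b) {x | ∃ a, g a = b ∧ f a = x}
        (by rintro _ ⟨a, rfl, rfl⟩; exact D.comm a)
        (fun y hy => by
          obtain ⟨a, h5, h6⟩ := D.ex y b hy
          exact ⟨_, ⟨a, h6, rfl⟩, h5⟩)
        (by
          rintro _ ⟨a, ha, rfl⟩ _ ⟨a', ha', rfl⟩ e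
          rw [D.inj _ _ e (by rw [ha, ha'])])
      refine ⟨b', D.sec_inj _ _ (by rw [h1, h5]) fun a a' ha ha' hi => ?_⟩
      obtain ⟨x, h7, h8⟩ := D'.ex (i (f a)) b' (by rw [D.comm, ha, h1])
      obtain ⟨a₁, h9, h10⟩ := h6 x h8
      rw [← D.inj a₁ a' (by rw [h10, h7, hi]) (by rw [h9, ha']), h10]
      exact h2 a x (by rw [ha, h8]) h7.symm
  refine ⟨l, m, ⟨fun a a' e => D'.inj _ _ ?_ (hm.1 ?_), fun a => ?_⟩, hm, hf, h4, h1⟩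
  · rw [← h3, ← h3, e]
  · rw [← h4, ← h4, e]
  · obtain ⟨b, hb⟩ := hm.2 (g a)
    obtain ⟨x, h5, h6⟩ := D'.ex (i (f a)) b (by rw [D.comm, ← h1, hb])
    exact ⟨x, D.inj _ _ (by rw [h3, h5]) (by rw [h4, h6, hb])⟩

theorem isDistributor_iff {X Y Z A B : FinGSet G} (i : Hom X Y) (j : Hom Y Z)
    (f : Hom A X) (g : Hom A B) (h : Hom B Z) : IsDistributor i j f g h ↔ IsDist i j f g h := by
  have C := isDist_canonical i j
  constructor
  · rintro ⟨α, β, -, -, h1, h2, h3⟩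
    have h1' : ∀ a, evalHom i j (α a) = f a := h1
    have h2' : ∀ a, β (g a) = pi2Hom i j (α a) := h2
    have h3' : ∀ b, pHom i j (β b) = h b := h3
    refine ⟨fun a => ?_, fun y b e => ?_, fun a a' e e' => ?_, fun z s h4 h5 h6 => ?_,
      fun b b' e H => ?_⟩
    · rw [← h1', ← h3', h2', C.comm]
    · obtain ⟨a, h4, h5⟩ := C.ex y (β b) (by rw [h3', e])
      exact ⟨α.symm a, by rw [← h1', α.apply_symm_apply, h4],
        β.injective (by rw [h2', α.apply_symm_apply, h5])⟩
    · exact α.injective (C.inj _ _ (by rw [h1', h1', e]) (by rw [← h2', ← h2', e']))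
    · obtain ⟨b, h7, h8⟩ := C.sec_ex z s h4 h5 h6
      refine ⟨β.symm b, by rw [← h3', β.apply_symm_apply, h7], fun a ha => ?_⟩
      rw [← h1']
      exact h8 _ (by rw [← h2', ha, β.apply_symm_apply])
    · refine β.injective (C.sec_inj _ _ (by rw [h3', h3', e]) fun a a' ha ha' hi => ?_)
      have := H (α.symm a) (α.symm a')
        (β.injective (by rw [h2', α.apply_symm_apply, ha]))
        (β.injective (by rw [h2', α.apply_symm_apply, ha']))
        (by rw [← h1', ← h1', α.apply_symm_apply, α.apply_symm_apply, hi])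
      rwa [← h1', ← h1', α.apply_symm_apply, α.apply_symm_apply] at this
  · intro D
    obtain ⟨l, m, hl, hm, h1, h2, h3⟩ :=
      IsDist.exists_iso (A := mkG G (ECan i j)) (B := mkG G (Sec i j)) C D
    exact ⟨Equiv.ofBijective l hl, Equiv.ofBijective m hm, fun c a => map_smul l c a,
      fun c a => map_smul m c a, h1, fun a => (h2 a).symm, h3⟩

theorem inlHom_injective (X Y : FinGSet G) : Function.Injective (inlHom X Y) :=
  Sum.inl_injective

theorem inrHom_injective (X Y : FinGSet G) : Function.Injective (inrHom X Y) :=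
  Sum.inr_injective

theorem isPB_inl {X Y X' Y' : FinGSet G} (f : Hom X X') (g : Hom Y Y') :
    IsPB f (inlHom X Y) (inlHom X' Y') (sumMapHom f g) where
  comm _ := rfl
  ex x y e := by
    obtain y | y := y
    · exact ⟨y, (Sum.inl_injective e).symm, rfl⟩
    · cases e
  inj a b _ e := Sum.inl_injective e

theorem isPB_inr {X Y X' Y' : FinGSet G} (f : Hom X X') (g : Hom Y Y') :
    IsPB g (inrHom X Y) (inrHom X' Y') (sumMapHom f g) where
  comm _ := rfl
  ex x y e := by
    obtain y | y := y
    · cases e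
    · exact ⟨y, (Sum.inr_injective e).symm, rfl⟩
  inj a b _ e := Sum.inr_injective e

theorem isPB_fold {X Y : FinGSet G} (f : Hom X Y) :
    IsPB (foldHom X) (sumMapHom f f) f (foldHom Y) where
  comm a := by cases a <;> rfl
  ex x y e := by
    obtain y | y := y
    · exact ⟨Sum.inl x, rfl, congrArg Sum.inl e⟩
    · exact ⟨Sum.inr x, rfl, congrArg Sum.inr e⟩
  inj a b e e' := by
    obtain a | a := a <;> obtain b | b := b
    · exact congrArg Sum.inl e
    · cases e'
    · cases e'
    · exact congrArg Sum.inr e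

theorem isPB_inl_inr (X Y : FinGSet G) :
    IsPB (initHom X) (initHom Y) (inlHom X Y) (inrHom X Y) where
  comm a := Empty.elim a
  ex x y e := by cases e
  inj a := Empty.elim a

/-- The `G`-set of pairs satisfying an invariant predicate. -/
def pairsG (P : FinGSet G) (S : P.carrier × P.carrier → Prop)
    (hS : ∀ (a : G) p, S p → S (a • p.1, a • p.2)) : FinGSet G where
  carrier := {p : P.carrier × P.carrier // S p}
  act :=
    { smul := fun a p => ⟨(a • p.1.1, a • p.1.2), hS a p.1 p.2⟩
      one_smul := fun p => Subtype.ext (Prod.ext (one_smul _ _) (one_smul _ _))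
      mul_smul := fun a b p => Subtype.ext (Prod.ext (mul_smul _ _ _) (mul_smul _ _ _)) }

namespace SemiMackey

variable (M : SemiMackey G)

theorem tr_res_pairs_congr {P : FinGSet G} {S T : P.carrier × P.carrier → Prop}
    (h : S = T) (hS : ∀ (a : G) p, S p → S (a • p.1, a • p.2))
    (hT : ∀ (a : G) p, T p → T (a • p.1, a • p.2)) (x : M.obj P) :
    M.tr (X := pairsG P S hS) (Y := P) ⟨fun p => p.1.1, fun _ _ => rfl⟩
      (M.res (X := pairsG P S hS) (Y := P) ⟨fun p => p.1.2, fun _ _ => rfl⟩ x) =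
    M.tr (X := pairsG P T hT) (Y := P) ⟨fun p => p.1.1, fun _ _ => rfl⟩
      (M.res (X := pairsG P T hT) (Y := P) ⟨fun p => p.1.2, fun _ _ => rfl⟩ x) := by
  subst h; rfl

theorem res_tr_of_injective {P Q : FinGSet G} (l : Hom P Q) (hl : Function.Injective l)
    (x : M.obj P) : M.res l (M.tr l x) = x := by
  have h1 := M.mackey (gid G P.carrier) (gid G P.carrier) x
  rw [M.res_id, M.tr_id] at h1
  have h2 := M.mackey l l x
  rw [h2]
  conv_rhs => rw [h1]
  exact M.tr_res_pairs_congr (S := fun p => l p.1 = l p.2) (T := fun p => p.1 = p.2)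
    (funext fun p => propext hl.eq_iff)
    (fun a p h => by show l (a • p.1) = l (a • p.2); rw [map_smul, map_smul]; exact congrArg _ h)
    (fun a p h => congrArg (a • ·) h) x

theorem res_res_inverse {X Y : FinGSet G} {f : Hom X Y} {e : Hom Y X} (h : ∀ x, e (f x) = x)
    (x : M.obj X) : M.res f (M.res e x) = x := by
  rw [M.res_comp, show gcomp e f = gid G X.carrier from Hom.ext h, M.res_id]

theorem tr_res_of_bijective {P Q : FinGSet G} (l : Hom P Q) (hl : Function.Bijective l)
    (x : M.obj Q) : M.tr l (M.res l x) = x := by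
  obtain ⟨e, he, h1, h2⟩ := exists_inverse l hl
  have : M.res e (M.res l (M.tr l (M.res l x))) = M.res e (M.res l x) := by
    rw [M.res_tr_of_injective l hl.1]
  rwa [M.res_res_inverse h2, M.res_res_inverse h2] at this

theorem tr_gcomp_res {P Q Z : FinGSet G} {l : Hom P Q} (hl : Function.Bijective l)
    (x : M.obj Q) (f : Hom Q Z) : M.tr (gcomp f l) (M.res l x) = M.tr f x := by
  rw [← M.tr_comp, M.tr_res_of_bijective l hl]

/-- The Mackey condition for an arbitrary pullback square. -/
theorem res_tr {P X Y Z : FinGSet G} {p : Hom P X} {q : Hom P Y} {f : Hom X Z}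
    {g : Hom Y Z} (H : IsPB p q f g) (y : M.obj Y) :
    M.res f (M.tr g y) = M.tr p (M.res q y) := by
  obtain ⟨Q, r, t, H', e⟩ : ∃ (Q : FinGSet G) (r : Hom Q X) (t : Hom Q Y),
      IsPB r t f g ∧ M.res f (M.tr g y) = M.tr r (M.res t y) :=
    ⟨mkG G (Pb f g), Pb.fstHom f g, Pb.sndHom f g, isPB_canonical f g, M.mackey f g y⟩
  obtain ⟨l, hl, h1, h2⟩ := H'.exists_iso H
  rw [e, ← M.tr_gcomp_res hl, M.res_comp, show gcomp r l = p from Hom.ext h1,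
    show gcomp t l = q from Hom.ext h2]

theorem pairElt_spec {X Y : FinGSet G} (x : M.obj X) (y : M.obj Y) :
    (M.res (inlHom X Y) (M.pairElt x y), M.res (inrHom X Y) (M.pairElt x y)) = (x, y) :=
  (Equiv.ofBijective _ (M.sum_bij X Y)).apply_symm_apply (x, y)

@[simp] theorem res_inl_pairElt {X Y : FinGSet G} (x : M.obj X) (y : M.obj Y) :
    M.res (inlHom X Y) (M.pairElt x y) = x := congrArg Prod.fst (M.pairElt_spec x y)

@[simp] theorem res_inr_pairElt {X Y : FinGSet G} (x : M.obj X) (y : M.obj Y) :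
    M.res (inrHom X Y) (M.pairElt x y) = y := congrArg Prod.snd (M.pairElt_spec x y)

theorem ext_sum {X Y : FinGSet G} {z w : M.obj (sumG X Y)}
    (h1 : M.res (inlHom X Y) z = M.res (inlHom X Y) w)
    (h2 : M.res (inrHom X Y) z = M.res (inrHom X Y) w) : z = w :=
  (M.sum_bij X Y).1 (Prod.ext h1 h2)

theorem res_sumMap {X Y X' Y' : FinGSet G} (f : Hom X X') (g : Hom Y Y')
    (x : M.obj X') (y : M.obj Y') :
    M.res (sumMapHom f g) (M.pairElt x y) = M.pairElt (M.res f x) (M.res g y) := by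
  apply M.ext_sum
  · rw [M.res_comp, res_inl_pairElt]
    have : gcomp (sumMapHom f g) (inlHom X Y) = gcomp (inlHom X' Y') f := rfl
    rw [this, ← M.res_comp, res_inl_pairElt]
  · rw [M.res_comp, res_inr_pairElt]
    have : gcomp (sumMapHom f g) (inrHom X Y) = gcomp (inrHom X' Y') g := rfl
    rw [this, ← M.res_comp, res_inr_pairElt]

theorem tr_sumMap {X Y X' Y' : FinGSet G} (f : Hom X X') (g : Hom Y Y')
    (x : M.obj X) (y : M.obj Y) :
    M.tr (sumMapHom f g) (M.pairElt x y) = M.pairElt (M.tr f x) (M.tr g y) := by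
  apply M.ext_sum
  · rw [M.res_tr (isPB_inl f g), res_inl_pairElt, res_inl_pairElt]
  · rw [M.res_tr (isPB_inr f g), res_inr_pairElt, res_inr_pairElt]

theorem tr_sumElim {X Y Z : FinGSet G} (f : Hom X Z) (g : Hom Y Z)
    (x : M.obj X) (y : M.obj Y) :
    M.tr (sumElimHom f g) (M.pairElt x y) = M.add (M.tr f x) (M.tr g y) := by
  rw [add, ← M.tr_sumMap, M.tr_comp]
  congr 1
  exact Hom.ext fun a => by cases a <;> rfl

theorem res_sumElim {X Y Z : FinGSet G} (f : Hom X Z) (g : Hom Y Z) (z : M.obj Z) :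
    M.res (sumElimHom f g) z = M.pairElt (M.res f z) (M.res g z) := by
  apply M.ext_sum
  · rw [M.res_comp, res_inl_pairElt]; rfl
  · rw [M.res_comp, res_inr_pairElt]; rfl

/-- Transfers are additive along decompositions of the source. -/
theorem tr_split {U₁ U₂ U Z : FinGSet G} (a₁ : Hom U₁ U) (a₂ : Hom U₂ U)
    (h : Function.Bijective (sumElimHom a₁ a₂)) (f : Hom U Z) (z : M.obj U) :
    M.tr f z =
      M.add (M.tr (gcomp f a₁) (M.res a₁ z)) (M.tr (gcomp f a₂) (M.res a₂ z)) := by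
  rw [← M.tr_gcomp_res h, res_sumElim, ← M.tr_sumElim]
  congr 1
  exact Hom.ext fun a => by cases a <;> rfl

theorem empty_eq (x y : M.obj (emptyG G)) : x = y := M.empty_subsingleton.elim x y

theorem tr_gcomp_eq {X Y : FinGSet G} {f g : Hom X Y} (h : ∀ x, f x = g x) (x : M.obj X) :
    M.tr f x = M.tr g x := by rw [Hom.ext h]

theorem tr_eq_self {X : FinGSet G} {f : Hom X X} (h : ∀ x, f x = x) (x : M.obj X) :
    M.tr f x = x := by rw [Hom.ext (g := gid G X.carrier) h, M.tr_id]

theorem bijective_swap (X Y : FinGSet G) :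
    Function.Bijective (sumElimHom (inrHom X Y) (inlHom X Y)) := by
  constructor
  · rintro (a | a) (b | b) e
    · exact congrArg _ (Sum.inr_injective e)
    · cases e
    · cases e
    · exact congrArg _ (Sum.inl_injective e)
  · rintro (a | a)
    · exact ⟨Sum.inr a, rfl⟩
    · exact ⟨Sum.inl a, rfl⟩

theorem bijective_inl_inr (X Y : FinGSet G) :
    Function.Bijective (sumElimHom (inlHom X Y) (inrHom X Y)) := by
  constructor
  · rintro (a | a) (b | b) e
    · exact congrArg _ (Sum.inl_injective e)
    · cases e
    · cases e
    · exact congrArg _ (Sum.inr_injective e)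
  · rintro (a | a)
    · exact ⟨Sum.inl a, rfl⟩
    · exact ⟨Sum.inr a, rfl⟩

theorem bijective_assoc (X Y Z : FinGSet G) :
    Function.Bijective (sumElimHom (gcomp (inlHom (sumG X Y) Z) (inlHom X Y))
      (sumElimHom (gcomp (inlHom (sumG X Y) Z) (inrHom X Y)) (inrHom (sumG X Y) Z))) :=
  (Equiv.sumAssoc X.carrier Y.carrier Z.carrier).symm.bijective

theorem bijective_gid_init (X : FinGSet G) :
    Function.Bijective (sumElimHom (gid G X.carrier) (initHom X)) := by
  constructor
  · rintro (a | a) (b | b) e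
    · exact congrArg Sum.inl e
    · exact Empty.elim b
    · exact Empty.elim a
    · exact Empty.elim a
  · exact fun a => ⟨Sum.inl a, rfl⟩

theorem add_comm' {X : FinGSet G} (x y : M.obj X) : M.add x y = M.add y x := by
  rw [add, M.tr_split _ _ (bijective_swap X X), res_inr_pairElt, res_inl_pairElt,
    M.tr_eq_self (fun _ => rfl), M.tr_eq_self (fun _ => rfl)]

theorem add_assoc' {X : FinGSet G} (x y z : M.obj X) :
    M.add (M.add x y) z = M.add x (M.add y z) := by
  have h : M.add (M.add x y) z =
      M.tr (sumElimHom (foldHom X) (gid G X.carrier)) (M.pairElt (M.pairElt x y) z) := by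
    rw [M.tr_sumElim, M.tr_id]; rfl
  rw [h, M.tr_split _ _ (bijective_assoc X X X), res_sumElim, ← M.res_comp, ← M.res_comp,
    res_inr_pairElt, res_inl_pairElt, res_inl_pairElt, res_inr_pairElt,
    M.tr_eq_self (fun _ => rfl)]
  congr 1
  refine M.tr_gcomp_eq (fun a => ?_) _
  cases a <;> rfl

theorem zero_eq {X : FinGSet G} (e : M.obj (emptyG G)) : M.tr (initHom X) e = M.zero X :=
  congrArg _ (M.empty_eq _ _)

theorem add_zero' {X : FinGSet G} (x : M.obj X) : M.add x (M.zero X) = x := by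
  conv_rhs => rw [← M.tr_id x, M.tr_split _ _ (bijective_gid_init X), M.res_id]
  rw [M.tr_eq_self (fun _ => rfl), M.tr_gcomp_eq (f := gcomp (gid G X.carrier) (initHom X)) (g := initHom X) (fun _ => rfl),
    M.zero_eq]

noncomputable instance (X : FinGSet G) : Add (M.obj X) := ⟨M.add⟩

noncomputable instance (X : FinGSet G) : Zero (M.obj X) := ⟨M.zero X⟩

noncomputable instance (X : FinGSet G) : AddCommMonoid (M.obj X) where
  add_assoc := M.add_assoc'
  add_comm := M.add_comm'
  add_zero := M.add_zero'
  zero_add x := (M.add_comm' _ _).trans (M.add_zero' x)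
  nsmul := nsmulRec

theorem add_eq {X : FinGSet G} (x y : M.obj X) : M.add x y = x + y := rfl

theorem zero_eq_zero (X : FinGSet G) : M.zero X = 0 := rfl

/-- Transfer as a homomorphism. -/
noncomputable def trHom {X Y : FinGSet G} (f : Hom X Y) : M.obj X →+ M.obj Y where
  toFun := M.tr f
  map_zero' := by
    rw [← M.zero_eq_zero, zero, M.tr_comp, M.tr_gcomp_eq (g := initHom Y), zero_eq, zero_eq_zero]
    exact fun a => Empty.elim a
  map_add' x y := by
    rw [← M.add_eq, ← M.add_eq, add, M.tr_comp, ← M.tr_sumElim]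
    refine M.tr_gcomp_eq (fun a => ?_) _
    cases a <;> rfl

/-- Restriction as a homomorphism. -/
noncomputable def resHom {X Y : FinGSet G} (f : Hom X Y) : M.obj Y →+ M.obj X where
  toFun := M.res f
  map_zero' := by
    have H : IsPB (initHom X) (gid G (emptyG G).carrier) f (initHom Y) :=
      ⟨fun a => Empty.elim a, fun _ b => Empty.elim b, fun a => Empty.elim a⟩
    rw [← M.zero_eq_zero, zero, M.res_tr H, zero_eq, zero_eq_zero]
  map_add' x y := by
    rw [← M.add_eq, ← M.add_eq, add, M.res_tr (isPB_fold f), M.res_sumMap]; rfl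

theorem sum_decomp {X Y : FinGSet G} (z : M.obj (sumG X Y)) :
    M.tr (inlHom X Y) (M.res (inlHom X Y) z) + M.tr (inrHom X Y) (M.res (inrHom X Y) z) = z := by
  conv_rhs => rw [← M.tr_id z, M.tr_split _ _ (bijective_inl_inr X Y)]
  rfl

theorem res_inl_tr_inr {X Y : FinGSet G} (y : M.obj Y) :
    M.res (inlHom X Y) (M.tr (inrHom X Y) y) = 0 := by
  rw [M.res_tr (isPB_inl_inr X Y), zero_eq, zero_eq_zero]

theorem res_inr_tr_inl {X Y : FinGSet G} (x : M.obj X) :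
    M.res (inrHom X Y) (M.tr (inlHom X Y) x) = 0 := by
  rw [M.res_tr (isPB_inl_inr X Y).symm, zero_eq, zero_eq_zero]

end SemiMackey

namespace SMackHom

variable {M N : SemiMackey G} (φ : SMackHom M N)

theorem app_pairElt {X Y : FinGSet G} (x : M.obj X) (y : M.obj Y) :
    φ.app _ (M.pairElt x y) = N.pairElt (φ.app _ x) (φ.app _ y) := by
  apply N.ext_sum <;> simp [← φ.app_res]

/-- The components of a map of semi-Mackey functors are additive. -/
noncomputable def appHom (X : FinGSet G) : M.obj X →+ N.obj X where
  toFun := φ.app X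
  map_zero' := by
    rw [← M.zero_eq_zero, SemiMackey.zero, φ.app_tr, N.zero_eq, N.zero_eq_zero]
  map_add' x y := by
    rw [← M.add_eq, ← N.add_eq, SemiMackey.add, φ.app_tr, φ.app_pairElt]; rfl

end SMackHom

namespace SemiTambara

variable (R : SemiTambara G)

/-- The semi-Mackey functor with the norms of `R` as transfers. -/
def multiplicative : SemiMackey G :=
  { R.toSemiMackey with
    tr := R.nm
    tr_id := R.nm_id
    tr_comp := R.nm_comp
    mackey := R.nm_res }

theorem res_nm {P X Y Z : FinGSet G} {p : Hom P X} {q : Hom P Y} {f : Hom X Z}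
    {g : Hom Y Z} (H : IsPB p q f g) (y : R.obj Y) :
    R.res f (R.nm g y) = R.nm p (R.res q y) :=
  R.multiplicative.res_tr H y

theorem nm_gcomp_res {P Q Z : FinGSet G} {l : Hom P Q} (hl : Function.Bijective l)
    (x : R.obj Q) (f : Hom Q Z) : R.nm (gcomp f l) (R.res l x) = R.nm f x :=
  R.multiplicative.tr_gcomp_res hl x f

theorem nm_tr {X Y Z A B : FinGSet G} {i : Hom X Y} {j : Hom Y Z} {f : Hom A X} {g : Hom A B}
    {h : Hom B Z} (D : IsDist i j f g h) (x : R.obj X) :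
    R.nm j (R.tr i x) = R.tr h (R.nm g (R.res f x)) :=
  R.distrib i j f g h ((isDistributor_iff i j f g h).2 D) x

end SemiTambara

theorem IsPB.of_bijective {X Y Z P X' : FinGSet G} {m : Hom X' X} (hm : Function.Bijective m)
    {p : Hom P X'} {q : Hom P Y} {f' : Hom X' Z} {f : Hom X Z} {g : Hom Y Z}
    (h : ∀ x, f (m x) = f' x) (H : IsPB p q f' g) : IsPB (gcomp m p) q f g where
  comm a := (h _).trans (H.comm a)
  ex x y e := by
    obtain ⟨x, rfl⟩ := hm.2 x
    obtain ⟨a, rfl, rfl⟩ := H.ex x y ((h x).symm.trans e)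
    exact ⟨a, rfl, rfl⟩
  inj a b e e' := H.inj a b (hm.1 e) e'

theorem IsPB.of_bijective₂ {X Y Z P X' Z' : FinGSet G} {l : Hom X' X} {m : Hom Z' Z}
    (hl : Function.Bijective l) (hm : Function.Bijective m)
    {p : Hom P X'} {q : Hom P Y} {f' : Hom X' Z'} {f : Hom X Z} {g : Hom Y Z'}
    (h : ∀ x, f (l x) = m (f' x)) (H : IsPB p q f' g) : IsPB (gcomp l p) q f (gcomp m g) where
  comm a := (h _).trans (congrArg m (H.comm a))
  ex x y e := by
    obtain ⟨x, rfl⟩ := hl.2 x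
    obtain ⟨a, rfl, rfl⟩ := H.ex x y (hm.1 ((h x).symm.trans e))
    exact ⟨a, rfl, rfl⟩
  inj a b e e' := H.inj a b (hl.1 e) e'

theorem IsDist.of_bijective {X X' Y Z A B : FinGSet G} {m : Hom X' X}
    (hm : Function.Bijective m) {i' : Hom X' Y} {i : Hom X Y} {j : Hom Y Z} {f : Hom A X'}
    {g : Hom A B} {h : Hom B Z} (hi : ∀ x, i (m x) = i' x) (D : IsDist i' j f g h) :
    IsDist i j (gcomp m f) g h := by
  obtain ⟨e, he, h1, h2⟩ := exists_inverse m hm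
  refine D.base_change (cX := e) (cY := fun x => x) (cZ := fun x => x) (cA := fun x => x)
    (cB := fun x => x) (IsPB.id_left _) ⟨fun x => ?_, fun x y h3 => ⟨m x, h1 x, ?_⟩, fun x y h3 _ => he.1 h3⟩
    (IsPB.id_left _) (IsPB.id_left _) (fun a => h1 _) (fun a => ?_)
  · rw [← hi, h2]
  · rw [hi]; exact h3
  · exact (congrArg j (hi _)).trans (D.comm a)

namespace sT

variable {M : SemiMackey G}

/-- The class of a representative of an element of `sT M X`. -/
def mk {U V X : FinGSet G} (i : Hom U V) (j : Hom V X) (u : M.obj U) : sT M X :=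
  Quot.mk _ ⟨U, V, i, j, u⟩

theorem ind {X : FinGSet G} {p : sT M X → Prop}
    (h : ∀ {U V : FinGSet G} (i : Hom U V) (j : Hom V X) (u : M.obj U), p (mk i j u))
    (x : sT M X) : p x := by
  obtain ⟨⟨U, V, i, j, u⟩⟩ := x
  exact h i j u

theorem mk_iso {U V U' V' X : FinGSet G} {i : Hom U V} {j : Hom V X} {i' : Hom U' V'}
    {j' : Hom V' X} {l : Hom U' U} {m : Hom V' V} (hl : Function.Bijective l)
    (hm : Function.Bijective m) (h1 : ∀ x, i (l x) = m (i' x)) (h2 : ∀ x, j (m x) = j' x)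
    (u : M.obj U) : mk i j u = mk i' j' (M.res l u) :=
  Quot.sound (STRel.iso ⟨Equiv.ofBijective l hl, Equiv.ofBijective m hm,
    fun g x => map_smul l g x, fun g x => map_smul m g x, h1, h2, rfl⟩)

theorem mk_tr {W U V X A B : FinGSet G} {k : Hom W U} {i : Hom U V} {f : Hom A W} {g : Hom A B}
    {h : Hom B V} (D : IsDist k i f g h) (j : Hom V X) (w : M.obj W) :
    mk i j (M.tr k w) = mk g (gcomp j h) (M.res f w) :=
  Quot.sound (STRel.distrib k i j f g h ((isDistributor_iff k i f g h).2 D) w)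

theorem mk_congr {U V X : FinGSet G} {i i' : Hom U V} {j j' : Hom V X} {u u' : M.obj U}
    (hi : ∀ x, i x = i' x) (hj : ∀ x, j x = j' x) (hu : u = u') :
    mk i j u = mk i' j' u' := by
  rw [Hom.ext hi, Hom.ext hj, hu]

/-- Independence of the restriction from the choice of pullbacks. -/
theorem mk_res_unique {U V X X' U₁ V₁ U₂ V₂ : FinGSet G} {i : Hom U V} {j : Hom V X}
    {f : Hom X' X} {v₁ : Hom V₁ V} {j₁ : Hom V₁ X'} (HV₁ : IsPB v₁ j₁ j f)
    {a₁ : Hom U₁ U} {i₁ : Hom U₁ V₁} (HU₁ : IsPB a₁ i₁ i v₁)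
    {v₂ : Hom V₂ V} {j₂ : Hom V₂ X'} (HV₂ : IsPB v₂ j₂ j f)
    {a₂ : Hom U₂ U} {i₂ : Hom U₂ V₂} (HU₂ : IsPB a₂ i₂ i v₂) (u : M.obj U) :
    mk i₁ j₁ (M.res a₁ u) = mk i₂ j₂ (M.res a₂ u) := by
  obtain ⟨m, hm, h1, h2⟩ := HV₁.exists_iso HV₂
  have HU : IsPB a₂ (gcomp m i₂) i v₁ := by
    have := (HU₂.symm.of_bijective hm h1).symm
    exact this
  obtain ⟨l, hl, h3, h4⟩ := HU₁.exists_iso HU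
  rw [mk_iso hl hm h4 h2, M.res_comp, show gcomp a₁ l = a₂ from Hom.ext h3]

/-- Independence of the norm from the choice of distributors and pullbacks. -/
theorem mk_nm_unique {U V X Y P₁ E₁ B₁ P₂ E₂ B₂ : FinGSet G} {i : Hom U V} {j : Hom V X}
    {f : Hom X Y} {a₁ : Hom E₁ V} {h₁ : Hom E₁ B₁} {k₁ : Hom B₁ Y} (D₁ : IsDist j f a₁ h₁ k₁)
    {p₁ : Hom P₁ U} {q₁ : Hom P₁ E₁} (H₁ : IsPB p₁ q₁ i a₁)
    {a₂ : Hom E₂ V} {h₂ : Hom E₂ B₂} {k₂ : Hom B₂ Y} (D₂ : IsDist j f a₂ h₂ k₂)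
    {p₂ : Hom P₂ U} {q₂ : Hom P₂ E₂} (H₂ : IsPB p₂ q₂ i a₂) (u : M.obj U) :
    mk (gcomp h₁ q₁) k₁ (M.res p₁ u) = mk (gcomp h₂ q₂) k₂ (M.res p₂ u) := by
  obtain ⟨l, m, hl, hm, h3, h4, h5⟩ := D₁.exists_iso D₂
  have HU : IsPB p₂ (gcomp l q₂) i a₁ := (H₂.symm.of_bijective hl h3).symm
  obtain ⟨t, ht, h6, h7⟩ := H₁.exists_iso HU
  rw [mk_iso (i' := gcomp h₂ q₂) ht hm (fun x => ?_) h5, M.res_comp,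
    show gcomp p₁ t = p₂ from Hom.ext h6]
  rw [gcomp_apply, h7, gcomp_apply, gcomp_apply, h4]

theorem mk_resPre {U V X X' U₁ V₁ : FinGSet G} {i : Hom U V} {j : Hom V X}
    {f : Hom X' X} {v₁ : Hom V₁ V} {j₁ : Hom V₁ X'} (HV₁ : IsPB v₁ j₁ j f)
    {a₁ : Hom U₁ U} {i₁ : Hom U₁ V₁} (HU₁ : IsPB a₁ i₁ i v₁) (u : M.obj U) :
    (Quot.mk _ (resPre M f ⟨U, V, i, j, u⟩) : sT M X') = mk i₁ j₁ (M.res a₁ u) :=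
  mk_res_unique (isPB_canonical j f) (U₁ := mkG G (Pb i (Pb.fstHom j f)))
    (V₁ := mkG G (Pb j f)) (isPB_canonical (Y := mkG G (Pb j f)) i (Pb.fstHom j f)) HV₁ HU₁ u

theorem mk_normPre {U V X Y P₁ E₁ B₁ : FinGSet G} {i : Hom U V} {j : Hom V X}
    {f : Hom X Y} {a₁ : Hom E₁ V} {h₁ : Hom E₁ B₁} {k₁ : Hom B₁ Y} (D₁ : IsDist j f a₁ h₁ k₁)
    {p₁ : Hom P₁ U} {q₁ : Hom P₁ E₁} (H₁ : IsPB p₁ q₁ i a₁) (u : M.obj U) :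
    (Quot.mk _ (normPre M f ⟨U, V, i, j, u⟩) : sT M Y) = mk (gcomp h₁ q₁) k₁ (M.res p₁ u) :=
  mk_nm_unique (P₁ := mkG G (Pb i (evalHom j f))) (E₁ := mkG G (ECan j f))
    (B₁ := mkG G (Sec j f)) (isDist_canonical j f)
    (isPB_canonical (Y := mkG G (ECan j f)) i (evalHom j f)) D₁ H₁ u

/-- Transfer on `sT M`. -/
def tr {X Y : FinGSet G} (f : Hom X Y) : sT M X → sT M Y :=
  Quot.lift (β := sT M _) (fun a => Quot.mk _ (trPre M f a)) (by
    rintro _ _ (⟨f, g, hf, hg, h1, h2, h3⟩ | ⟨k, i, j, f, g, h, D, w⟩)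
    · exact Quot.sound (STRel.iso ⟨f, g, hf, hg, h1, fun v => congrArg _ (h2 v), h3⟩)
    · exact Quot.sound (STRel.distrib k i _ f g h D w))

theorem tr_mk {U V X Y : FinGSet G} (f : Hom X Y) (i : Hom U V) (j : Hom V X) (u : M.obj U) :
    tr f (mk i j u) = mk i (gcomp f j) u := rfl

/-- Restriction on `sT M`. -/
def res {X Y : FinGSet G} (φ : Hom X Y) : sT M Y → sT M X :=
  Quot.lift (β := sT M _) (fun a => Quot.mk _ (resPre M φ a)) (by
    rintro _ _ (⟨l, m, hl, hm, h1, h2, h3⟩ | ⟨k, i, j, f, g, h, D, w⟩)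
    · rename_i a b
      obtain ⟨U, V, i, j, u⟩ := a
      obtain ⟨U', V', i', j', u'⟩ := b
      obtain ⟨V₁, v₁, j₁, HV⟩ := exists_isPB j' φ
      obtain ⟨U₁, a₁, i₁, HU⟩ := exists_isPB i' v₁
      dsimp only at h1 h2 h3 l m hl hm
      refine (mk_resPre (HV.of_bijective (m := ⟨m, hm⟩) m.bijective h2)
        (HU.of_bijective₂ (l := ⟨l, hl⟩) (m := ⟨m, hm⟩) l.bijective m.bijective h1) u).trans
        (Eq.trans (congrArg (mk i₁ j₁) ?_) (mk_resPre HV HU u').symm)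
      exact (M.res_comp _ _ _).symm.trans (congrArg (M.res a₁) h3)
    · rename_i W U V A B
      rw [isDistributor_iff] at D
      obtain ⟨V', cV, j', HV⟩ := exists_isPB j φ
      obtain ⟨U', cU, i', HU⟩ := exists_isPB i cV
      obtain ⟨W', cW, k', HW⟩ := exists_isPB k cU
      obtain ⟨B', cB, h', HB⟩ := exists_isPB h cV
      obtain ⟨A', cA, g', HA⟩ := exists_isPB g cB
      obtain ⟨r, hr1, hr2⟩ := HU.lift (gcomp k (gcomp f cA)) (gcomp h' g') (fun t => by
        simp only [gcomp_apply]; rw [D.comm, HA.comm, HB.comm])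
      obtain ⟨f', h3, h4⟩ := HW.lift (gcomp f cA) r (fun t => (hr1 t).symm)
      have D' : IsDist k' i' f' g' h' := D.base_change HU HW HB HA h3
        (fun a => by rw [h4, hr2]; rfl)
      refine (mk_resPre HV HU _).trans ?_
      rw [M.res_tr HW.symm, mk_tr D', M.res_comp, show gcomp cW f' = gcomp f cA from Hom.ext h3,
        ← M.res_comp]
      exact (mk_resPre (j₁ := gcomp j' h') (HV.symm.paste HB.symm).symm HA _).symm)

theorem res_mk {U V X X' U₁ V₁ : FinGSet G} {i : Hom U V} {j : Hom V X}
    {f : Hom X' X} {v₁ : Hom V₁ V} {j₁ : Hom V₁ X'} (HV₁ : IsPB v₁ j₁ j f)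
    {a₁ : Hom U₁ U} {i₁ : Hom U₁ V₁} (HU₁ : IsPB a₁ i₁ i v₁) (u : M.obj U) :
    res f (mk i j u) = mk i₁ j₁ (M.res a₁ u) := mk_resPre HV₁ HU₁ u

/-- Norm on `sT M`. -/
def nm {X Y : FinGSet G} (φ : Hom X Y) : sT M X → sT M Y :=
  Quot.lift (β := sT M _) (fun a => Quot.mk _ (normPre M φ a)) (by
    rintro _ _ (⟨l, m, hl, hm, h1, h2, h3⟩ | ⟨k, i, j, f, g, h, D, x⟩)
    · rename_i a b
      obtain ⟨U, V, i, j, u⟩ := a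
      obtain ⟨U', V', i', j', u'⟩ := b
      obtain ⟨E, B, a, h, k, D⟩ := exists_isDist j' φ
      obtain ⟨P, p, q, H⟩ := exists_isPB i' a
      dsimp only at h1 h2 h3 l m hl hm
      refine (mk_normPre (D.of_bijective (m := ⟨m, hm⟩) m.bijective h2)
        (H.of_bijective₂ (l := ⟨l, hl⟩) (m := ⟨m, hm⟩) l.bijective m.bijective h1) u).trans
        (Eq.trans (congrArg (mk (gcomp h q) k) ?_) (mk_normPre D H u').symm)
      exact (M.res_comp _ _ _).symm.trans (congrArg (M.res p) h3)
    · rename_i W U V A B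
      rw [isDistributor_iff] at D
      obtain ⟨E, B₁, a, h₁, k₁, D₁⟩ := exists_isDist j φ
      obtain ⟨P, pU, pE, HP⟩ := exists_isPB i a
      obtain ⟨W', w, k', HW⟩ := exists_isPB k pU
      obtain ⟨A₂, B₂, f₂, g₂, h₂, D₂⟩ := exists_isDist k' (gcomp h₁ pE)
      obtain ⟨E₂, e₁, e₂, HE⟩ := exists_isPB h₁ h₂
      obtain ⟨m, hm₁, hm₂⟩ := HE.lift (gcomp pE (gcomp k' f₂)) g₂ D₂.comm
      have HQ : IsPB (gcomp pU (gcomp k' f₂)) m i (gcomp a e₁) := by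
        constructor
        · intro t
          simp only [gcomp_apply]
          rw [HP.comm, hm₁]; rfl
        · intro u x e
          obtain ⟨p, h3, h4⟩ := HP.ex u _ e
          obtain ⟨t, h5, h6⟩ := D₂.ex p (e₂ x) (by rw [gcomp_apply, h4, HE.comm])
          refine ⟨t, by simp only [gcomp_apply]; rw [h5, h3], HE.inj _ _ ?_ ?_⟩
          · rw [hm₁, ← h4, ← h5]; rfl
          · rw [hm₂, h6]
        · intro t t' e e'
          refine D₂.inj _ _ (HP.inj _ _ e ?_) ?_
          · have := congrArg e₁ e'
            rwa [hm₁, hm₁] at this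
          · rw [← hm₂, ← hm₂, e']
      obtain ⟨a₂, ha₂, hlift⟩ := D.lift HQ (gcomp w f₂) (fun t => HW.comm _ |>.symm ▸ rfl)
      obtain ⟨n, hn₁, hn₂⟩ := IsPB.lift (p := gcomp k f) D.isPB (gcomp pU (gcomp k' f₂))
        (gcomp a₂ m) (fun t => by rw [HQ.comm]; exact (ha₂ _).symm)
      have hn : ∀ t, f (n t) = w (f₂ t) := fun t => hlift (n t) t (hn₂ t) (hn₁ t)
      have D₃ : IsDist (gcomp j h) φ a₂ e₂ (gcomp k₁ h₂) :=
        IsDist.distrib_norm D D₁ HP HW D₂ HE ha₂ (fun x t h3 h4 a' h5 h6 => by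
          have hx : m t = x := HE.inj _ _ (by rw [hm₁]; exact h4) (by rw [hm₂]; exact h3)
          exact hlift a' t (by rw [h5, hx]) h6)
      have H₃ : IsPB n m g a₂ := IsDist.distrib_norm_isPB D HP HW D₂ HE ha₂ hm₁ hm₂ hn₂ hn
      refine (mk_normPre D₁ HP _).trans (Eq.trans ?_ (mk_normPre D₃ H₃ _).symm)
      rw [M.res_tr HW.symm, mk_tr D₂, M.res_comp, M.res_comp]
      refine mk_congr (fun t => (hm₂ t).symm) (fun _ => rfl) ?_
      rw [show gcomp f n = gcomp w f₂ from Hom.ext hn])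

theorem nm_mk {U V X Y P₁ E₁ B₁ : FinGSet G} {i : Hom U V} {j : Hom V X}
    {f : Hom X Y} {a₁ : Hom E₁ V} {h₁ : Hom E₁ B₁} {k₁ : Hom B₁ Y} (D₁ : IsDist j f a₁ h₁ k₁)
    {p₁ : Hom P₁ U} {q₁ : Hom P₁ E₁} (H₁ : IsPB p₁ q₁ i a₁) (u : M.obj U) :
    nm f (mk i j u) = mk (gcomp h₁ q₁) k₁ (M.res p₁ u) := mk_normPre D₁ H₁ u

end sT

theorem IsPB.bijective_sumElim {V₁ V₂ V U₁ U₂ U : FinGSet G} {v₁ : Hom V₁ V} {v₂ : Hom V₂ V}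
    (hv : Function.Bijective (sumElimHom v₁ v₂)) {i : Hom U V} {a₁ : Hom U₁ U} {i₁ : Hom U₁ V₁}
    (H₁ : IsPB a₁ i₁ i v₁) {a₂ : Hom U₂ U} {i₂ : Hom U₂ V₂} (H₂ : IsPB a₂ i₂ i v₂) :
    Function.Bijective (sumElimHom a₁ a₂) := by
  have key : ∀ x, sumElimHom v₁ v₂ (sumMapHom i₁ i₂ x) = i (sumElimHom a₁ a₂ x) := by
    rintro (x | x)
    · exact (H₁.comm x).symm
    · exact (H₂.comm x).symm
  constructor
  · intro x y e
    have h1 := hv.1 ((key x).trans ((congrArg i e).trans (key y).symm))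
    obtain x | x := x <;> obtain y | y := y
    · exact congrArg Sum.inl (H₁.inj x y e (Sum.inl_injective h1))
    · cases h1
    · cases h1
    · exact congrArg Sum.inr (H₂.inj x y e (Sum.inr_injective h1))
  · intro x
    obtain ⟨v | v, hv'⟩ := hv.2 (i x)
    · obtain ⟨y, h, -⟩ := H₁.ex x v hv'.symm
      exact ⟨Sum.inl y, h⟩
    · obtain ⟨y, h, -⟩ := H₂.ex x v hv'.symm
      exact ⟨Sum.inr y, h⟩

namespace sT

variable {M : SemiMackey G}

theorem res_id' {X : FinGSet G} (x : sT M X) : res (gid G X.carrier) x = x := by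
  induction x using ind with
  | _ i j u =>
    rw [res_mk (v₁ := gid G _) (j₁ := j) (IsPB.id_left _) (a₁ := gid G _) (i₁ := i)
      (IsPB.id_left _), M.res_id]

theorem res_comp' {X Y Z : FinGSet G} (i : Hom X Y) (j : Hom Y Z) (z : sT M Z) :
    res i (res j z) = res (gcomp j i) z := by
  induction z using ind with
  | _ p q u =>
    obtain ⟨V', v, q', HV⟩ := exists_isPB q j
    obtain ⟨U', a, p', HU⟩ := exists_isPB p v
    obtain ⟨V₂, v₂, q₂, HV₂⟩ := exists_isPB q' i
    obtain ⟨U₂, a₂, p₂, HU₂⟩ := exists_isPB p' v₂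
    rw [res_mk HV HU, res_mk HV₂ HU₂, M.res_comp]
    have H := HV.paste HV₂
    exact (res_mk (f := gcomp j i) (v₁ := gcomp v v₂) H (a₁ := gcomp a a₂) (HU.paste HU₂) u).symm

theorem res_tr' {P X Y Z : FinGSet G} {p : Hom P X} {q : Hom P Y} {f : Hom X Z}
    {g : Hom Y Z} (H : IsPB p q f g) (y : sT M Y) : res f (tr g y) = tr p (res q y) := by
  induction y using ind with
  | _ i j u =>
    obtain ⟨V', v, j', HV⟩ := exists_isPB j q
    obtain ⟨U', a, i', HU⟩ := exists_isPB i v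
    rw [tr_mk, res_mk HV HU, tr_mk]
    exact res_mk (j₁ := gcomp p j') (H.paste HV.symm).symm HU u

theorem nm_id' {X : FinGSet G} (x : sT M X) : nm (gid G X.carrier) x = x := by
  induction x using ind with
  | _ i j u =>
    exact (nm_mk (a₁ := gid G _) (h₁ := gid G _) (k₁ := j) (IsDist.id_norm j)
      (p₁ := gid G _) (q₁ := i) (IsPB.id_left _) u).trans (congrArg (mk i j) (M.res_id u))

theorem nm_comp' {X Y Z : FinGSet G} (f : Hom X Y) (f' : Hom Y Z) (x : sT M X) :
    nm f' (nm f x) = nm (gcomp f' f) x := by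
  induction x using ind with
  | _ i j u =>
    obtain ⟨E, B, a, h, k, D⟩ := exists_isDist j f
    obtain ⟨P, pU, pE, HP⟩ := exists_isPB i a
    obtain ⟨A', B', a', h', k', D'⟩ := exists_isDist k f'
    obtain ⟨Q, r, s, HQ⟩ := exists_isPB (gcomp h pE) a'
    obtain ⟨R, p, q, H⟩ := exists_isPB h a'
    obtain ⟨t, ht₁, ht₂⟩ := H.lift (gcomp pE r) s HQ.comm
    have HT : IsPB t r p pE := by
      refine H.symm.cancel (t := r) ?_ ht₁
      have := HQ.symm
      rwa [show (⇑s : Q.carrier → A'.carrier) = fun x => q (t x) from funext fun x => (ht₂ x).symm]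
        at this
    rw [nm_mk D HP, nm_mk D' HQ, M.res_comp]
    refine Eq.trans (mk_congr (fun x => ?_) (fun _ => rfl) rfl)
      (nm_mk (a₁ := gcomp a p) (h₁ := gcomp h' q) (D.comp_norm D' H) (p₁ := gcomp pU r)
        (q₁ := t) (HP.paste HT.symm) u).symm
    exact congrArg h' (ht₂ x).symm

theorem res_nm' {P X Y Z : FinGSet G} {p : Hom P X} {q : Hom P Y} {f : Hom X Z}
    {g : Hom Y Z} (H : IsPB p q f g) (y : sT M Y) : res f (nm g y) = nm p (res q y) := by
  induction y using ind with
  | _ i j u =>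
    obtain ⟨V', v, j', HV⟩ := exists_isPB j q
    obtain ⟨U', a, i', HU⟩ := exists_isPB i v
    obtain ⟨E, B, a₁, h, k, D⟩ := exists_isDist j g
    obtain ⟨R, pU, pE, HPU⟩ := exists_isPB i a₁
    obtain ⟨B', cB, k', HB⟩ := exists_isPB k f
    obtain ⟨E', cE, h', HE⟩ := exists_isPB h cB
    obtain ⟨P', cP, pE', HP⟩ := exists_isPB pE cE
    obtain ⟨r, hr₁, hr₂⟩ := H.lift (gcomp k' h') (gcomp j (gcomp a₁ cE)) (fun t => by
      simp only [gcomp_apply]; rw [← HB.comm, ← HE.comm, D.comm])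
    obtain ⟨f', hf₁, hf₂⟩ := HV.lift (gcomp a₁ cE) r (fun t => (hr₂ t).symm)
    have D' : IsDist j' p f' h' k' := D.base_change H.symm HV HB HE hf₁
      (fun x => by rw [hf₂, hr₁]; rfl)
    obtain ⟨pU', hp₁, hp₂⟩ := HU.lift (gcomp pU cP) (gcomp f' pE') (fun t => by
      simp only [gcomp_apply]; rw [HPU.comm, HP.comm, hf₁]; rfl)
    have H' : IsPB pU' pE' i' f' := by
      refine HU.cancel ?_ hp₂
      have h1 : IsPB (fun x => pU (cP x)) pE' i (fun x => a₁ (cE x)) := HPU.paste HP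
      rwa [show (fun x => pU (cP x)) = fun x => a (pU' x) from funext fun x => (hp₁ x).symm,
        show (fun x => a₁ (cE x)) = fun x => v (f' x) from funext fun x => (hf₁ x).symm] at h1
    rw [nm_mk D HPU, res_mk HV HU, nm_mk D' H', M.res_comp,
      show gcomp a pU' = gcomp pU cP from Hom.ext hp₁, ← M.res_comp]
    exact res_mk HB (i₁ := gcomp h' pE') (HE.symm.paste HP.symm).symm _

theorem nm_tr' {X Y Z A B : FinGSet G} {i : Hom X Y} {j : Hom Y Z} {f : Hom A X} {g : Hom A B}
    {h : Hom B Z} (D : IsDist i j f g h) (x : sT M X) :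
    nm j (tr i x) = tr h (nm g (res f x)) := by
  induction x using ind with
  | _ i₀ v u =>
    obtain ⟨P, p, q, H⟩ := exists_isPB v f
    obtain ⟨U', a, i', HU⟩ := exists_isPB i₀ p
    obtain ⟨E, B', a', h₁, k₁, D'⟩ := exists_isDist q g
    obtain ⟨R, r, s, HR⟩ := exists_isPB i' a'
    rw [res_mk H HU, nm_mk D' HR, tr_mk, tr_mk, M.res_comp]
    exact nm_mk (a₁ := gcomp p a') (k₁ := gcomp h k₁) (D.comp_tr H D') (p₁ := gcomp a r)
      (HU.paste HR) u

/-- The element of `sT M (X ⊔ Y)` with given restrictions to `X` and `Y`. -/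
noncomputable def sum {X Y : FinGSet G} : sT M X → sT M Y → sT M (sumG X Y) :=
  Quot.lift (β := sT M Y → sT M (sumG X Y))
    (fun a => Quot.lift (β := sT M (sumG X Y))
      (fun b => mk (sumMapHom a.i b.i) (sumMapHom a.j b.j) (M.pairElt a.u b.u)) (by
        rintro _ _ (⟨l, m, hl, hm, h1, h2, h3⟩ | ⟨k, i, j, f, g, h, D, w⟩)
        · refine (mk_iso (l := sumMapHom (gid G _) ⟨l, hl⟩) (m := sumMapHom (gid G _) ⟨m, hm⟩)
            (Function.bijective_id.sumMap l.bijective)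
            (Function.bijective_id.sumMap m.bijective) ?_ ?_ _).trans
            (congrArg (mk _ _) ?_)
          · rintro (x | x)
            · rfl
            · exact congrArg Sum.inr (h1 x)
          · rintro (x | x)
            · rfl
            · exact congrArg Sum.inr (h2 x)
          · rw [M.res_sumMap, M.res_id]
            exact congrArg _ h3
        · rw [isDistributor_iff] at D
          have e := M.tr_sumMap (gid G _) k a.u w
          rw [M.tr_id] at e
          dsimp only
          rw [← e]
          refine (mk_tr (f := sumMapHom (gid G _) f) (g := sumMapHom a.i g)
            (h := sumMapHom (gid G _) h) ((IsDist.id_tr a.i).sum_map D) _ _).trans ?_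
          rw [M.res_sumMap, M.res_id]
          exact mk_congr (fun _ => rfl) (fun x => by cases x <;> rfl) rfl))
    (by
      intro a a' haa
      funext b
      obtain ⟨b⟩ := b
      obtain ⟨l, m, hl, hm, h1, h2, h3⟩ | ⟨k, i, j, f, g, h, D, w⟩ := haa
      · refine (mk_iso (l := sumMapHom ⟨l, hl⟩ (gid G _)) (m := sumMapHom ⟨m, hm⟩ (gid G _))
          (l.bijective.sumMap Function.bijective_id)
          (m.bijective.sumMap Function.bijective_id) ?_ ?_ _).trans
          (congrArg (mk _ _) ?_)
        · rintro (x | x)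
          · exact congrArg Sum.inl (h1 x)
          · rfl
        · rintro (x | x)
          · exact congrArg Sum.inl (h2 x)
          · rfl
        · rw [M.res_sumMap, M.res_id]
          exact congrArg (fun z => M.pairElt z b.u) h3
      · rw [isDistributor_iff] at D
        have e := M.tr_sumMap k (gid G _) w b.u
        rw [M.tr_id] at e
        dsimp only
        rw [← e]
        refine (mk_tr (f := sumMapHom f (gid G _)) (g := sumMapHom g b.i)
          (h := sumMapHom h (gid G _)) (D.sum_map (IsDist.id_tr b.i)) _ _).trans ?_
        rw [M.res_sumMap, M.res_id]
        exact mk_congr (fun _ => rfl) (fun x => by cases x <;> rfl) rfl)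

theorem sum_mk {X Y U V U' V' : FinGSet G} (i : Hom U V) (j : Hom V X) (u : M.obj U)
    (i' : Hom U' V') (j' : Hom V' Y) (u' : M.obj U') :
    sum (mk i j u) (mk i' j' u') =
      mk (sumMapHom i i') (sumMapHom j j') (M.pairElt u u') := rfl

theorem sum_res {X Y : FinGSet G} (z : sT M (sumG X Y)) :
    sum (res (inlHom X Y) z) (res (inrHom X Y) z) = z := by
  induction z using ind with
  | _ i j u =>
    obtain ⟨V₁, v₁, j₁, HV₁⟩ := exists_isPB j (inlHom X Y)
    obtain ⟨U₁, a₁, i₁, HU₁⟩ := exists_isPB i v₁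
    obtain ⟨V₂, v₂, j₂, HV₂⟩ := exists_isPB j (inrHom X Y)
    obtain ⟨U₂, a₂, i₂, HU₂⟩ := exists_isPB i v₂
    have hv := IsPB.bijective_sumElim (SemiMackey.bijective_inl_inr X Y) HV₁ HV₂
    have hu := IsPB.bijective_sumElim hv HU₁ HU₂
    rw [res_mk HV₁ HU₁, res_mk HV₂ HU₂, sum_mk, ← M.res_sumElim]
    refine (mk_iso hu hv ?_ ?_ u).symm
    · rintro (x | x)
      · exact HU₁.comm x
      · exact HU₂.comm x
    · rintro (x | x)
      · exact HV₁.comm x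
      · exact HV₂.comm x

theorem res_inl_sum {X Y : FinGSet G} (x : sT M X) (y : sT M Y) :
    res (inlHom X Y) (sum x y) = x := by
  induction x using ind with
  | _ i j u =>
    induction y using ind with
    | _ i' j' u' =>
      rw [sum_mk, res_mk (isPB_inl j j').symm (isPB_inl i i').symm, M.res_inl_pairElt]

theorem res_inr_sum {X Y : FinGSet G} (x : sT M X) (y : sT M Y) :
    res (inrHom X Y) (sum x y) = y := by
  induction x using ind with
  | _ i j u =>
    induction y using ind with
    | _ i' j' u' =>
      rw [sum_mk, res_mk (isPB_inr j j').symm (isPB_inr i i').symm, M.res_inr_pairElt]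

theorem obj_eq_of_isEmpty {U : FinGSet G} (h : IsEmpty U.carrier) (x y : M.obj U) : x = y := by
  let e : Hom U (emptyG G) := ⟨fun a => h.elim a, fun _ a => h.elim a⟩
  rw [← M.res_res_inverse (f := e) (e := initHom U) (fun a => h.elim a) x,
    M.empty_eq (M.res (initHom U) x) (M.res (initHom U) y), M.res_res_inverse]
  exact fun a => h.elim a

theorem subsingleton_empty : Subsingleton (sT M (emptyG G)) where
  allEq x y := by
    induction x using ind with
    | @h U V i j u =>
      induction y using ind with
      | @h U' V' i' j' u' =>
        have hV : IsEmpty V.carrier := ⟨fun v => Empty.elim (j v)⟩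
        have hU : IsEmpty U.carrier := ⟨fun v => hV.elim (i v)⟩
        have hV' : IsEmpty V'.carrier := ⟨fun v => Empty.elim (j' v)⟩
        have hU' : IsEmpty U'.carrier := ⟨fun v => hV'.elim (i' v)⟩
        rw [obj_eq_of_isEmpty hU' u' (M.res ⟨fun a => hU'.elim a, fun _ a => hU'.elim a⟩ u)]
        exact mk_iso (m := ⟨fun a => hV'.elim a, fun _ a => hV'.elim a⟩)
          ⟨fun a => hU'.elim a, fun a => hU.elim a⟩ ⟨fun a => hV'.elim a, fun a => hV.elim a⟩
          (fun a => hU'.elim a) (fun a => hV'.elim a) u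

end sT

/-- The free semi-Tambara functor on a semi-Mackey functor. -/
noncomputable def freeSemiTambara (M : SemiMackey G) : SemiTambara G where
  obj := sT M
  nonempty X := ⟨sT.mk (initHom (emptyG G)) (initHom X) (M.nonempty (emptyG G)).some⟩
  res := sT.res
  tr := sT.tr
  res_id := sT.res_id'
  res_comp := sT.res_comp'
  tr_id x := by
    induction x using sT.ind with
    | _ i j u => rfl
  tr_comp f g x := by
    induction x using sT.ind with
    | _ i j u => rfl
  mackey f g := sT.res_tr' (P := mkG G (Pb f g)) (isPB_canonical f g)
  sum_bij X Y := by
    constructor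
    · intro z w e
      rw [← sT.sum_res z, ← sT.sum_res w]
      exact congrArg (fun p : sT M X × sT M Y => sT.sum p.1 p.2) e
    · rintro ⟨x, y⟩
      exact ⟨sT.sum x y, Prod.ext (sT.res_inl_sum x y) (sT.res_inr_sum x y)⟩
  empty_subsingleton := sT.subsingleton_empty
  nm := sT.nm
  nm_id := sT.nm_id'
  nm_comp := sT.nm_comp'
  nm_res f g := sT.res_nm' (P := mkG G (Pb f g)) (isPB_canonical f g)
  distrib i j f g h D := sT.nm_tr' ((isDistributor_iff i j f g h).1 D)

namespace sT

variable {M : SemiMackey G}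

theorem pairElt_mk {X Y U V U' V' : FinGSet G} (i : Hom U V) (j : Hom V X) (u : M.obj U)
    (i' : Hom U' V') (j' : Hom V' Y) (u' : M.obj U') :
    (freeSemiTambara M).pairElt (X := X) (Y := Y) (mk i j u) (mk i' j' u') =
      mk (sumMapHom i i') (sumMapHom j j') (M.pairElt u u') := by
  apply (freeSemiTambara M).ext_sum
  · exact ((freeSemiTambara M).res_inl_pairElt _ _).trans
      (res_inl_sum (mk i j u) (mk i' j' u')).symm
  · exact ((freeSemiTambara M).res_inr_pairElt _ _).trans
      (res_inr_sum (mk i j u) (mk i' j' u')).symm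

theorem mk_addPre {X : FinGSet G} (a b : PreT M X) :
    (Quot.mk _ (addPre M a b) : sT M X) =
      (freeSemiTambara M).add (X := X) (Quot.mk _ a) (Quot.mk _ b) := by
  have h : (freeSemiTambara M).add (X := X) (mk a.i a.j a.u) (mk b.i b.j b.u) =
      tr (foldHom X) (mk (sumMapHom a.i b.i) (sumMapHom a.j b.j) (M.pairElt a.u b.u)) :=
    congrArg (tr (foldHom X)) (pairElt_mk _ _ _ _ _ _)
  refine Eq.trans ?_ h.symm
  exact mk_congr (fun _ => rfl) (fun x => by cases x <;> rfl) rfl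

/-- The universal map `θ_M : M → sT M`. -/
def theta {X : FinGSet G} (x : M.obj X) : sT M X := Quot.mk _ (thetaPre M X x)

theorem nm_theta {U V : FinGSet G} (i : Hom U V) (u : M.obj U) :
    nm i (theta u) = mk i (gid G V.carrier) u := by
  refine (nm_mk (a₁ := gid G _) (h₁ := i) (k₁ := gid G _) (IsDist.id_tr i) (p₁ := gid G _)
    (q₁ := gid G _) (IsPB.id_left _) u).trans ?_
  rw [M.res_id]; rfl

theorem mk_eq {U V X : FinGSet G} (i : Hom U V) (j : Hom V X) (u : M.obj U) :
    mk i j u = tr j (nm i (theta u)) := by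
  rw [nm_theta]; rfl

end sT

section Lift

variable {M : SemiMackey G} (R : SemiTambara G) (φ : SMackHom M R.toSemiMackey)

/-- The extension of a map `M → R` of semi-Mackey functors to the free semi-Tambara functor. -/
def sT.lift (X : FinGSet G) : sT M X → R.obj X :=
  Quot.lift (fun a => R.tr a.j (R.nm a.i (φ.app _ a.u))) (by
    rintro ⟨U, V, i, j, u⟩ ⟨U', V', i', j', u'⟩ (⟨l, m, hl, hm, h1, h2, h3⟩ | ⟨k, i, j, f, g, h, D, w⟩)
    · dsimp only at *
      have hu : u' = M.res ⟨l, hl⟩ u := h3.symm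
      have hj : j' = gcomp j ⟨m, hm⟩ := Hom.ext fun x => (h2 x).symm
      have H : IsPB (⟨l, hl⟩ : Hom U' U) i' i (⟨m, hm⟩ : Hom V' V) :=
        ⟨h1, fun x y e => ⟨l.symm x, l.apply_symm_apply x, m.injective (by
          have := h1 (l.symm x)
          rw [l.apply_symm_apply] at this
          exact this.symm.trans e)⟩, fun a b e _ => l.injective e⟩
      rw [hu, hj, φ.app_res, ← R.tr_comp, ← R.res_nm H.symm]
      exact congrArg _ (R.tr_res_of_bijective (⟨m, hm⟩ : Hom V' V) m.bijective _).symm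
    · dsimp only
      rw [isDistributor_iff] at D
      rw [φ.app_tr, R.nm_tr D, R.tr_comp, φ.app_res])

theorem sT.lift_mk {U V X : FinGSet G} (i : Hom U V) (j : Hom V X) (u : M.obj U) :
    sT.lift R φ X (sT.mk i j u) = R.tr j (R.nm i (φ.app _ u)) := rfl

/-- The extension of a map `M → R` of semi-Mackey functors to the free semi-Tambara functor,
as a map of semi-Tambara functors. -/
def liftHom : STambHom (freeSemiTambara M) R where
  app := sT.lift R φ
  app_res {X Y} f y := by
    revert y
    refine sT.ind fun i j u => ?_
    obtain ⟨V', v, j', HV⟩ := exists_isPB j f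
    obtain ⟨U', a, i', HU⟩ := exists_isPB i v
    refine (congrArg _ (sT.res_mk HV HU u)).trans ?_
    rw [sT.lift_mk, sT.lift_mk, R.res_tr HV.symm, R.res_nm HU.symm, φ.app_res]
  app_tr {X Y} f x := by
    revert x
    refine sT.ind fun i j u => ?_
    refine (congrArg _ (sT.tr_mk f i j u)).trans ?_
    rw [sT.lift_mk, sT.lift_mk, R.tr_comp]
  app_nm {X Y} f x := by
    revert x
    refine sT.ind fun i j u => ?_
    obtain ⟨E, B, a, h, k, D⟩ := exists_isDist j f
    obtain ⟨P, p, q, H⟩ := exists_isPB i a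
    refine (congrArg _ (sT.nm_mk D H u)).trans ?_
    rw [sT.lift_mk, sT.lift_mk, R.nm_tr D, R.res_nm H.symm, R.nm_comp, φ.app_res]

theorem liftHom_theta {X : FinGSet G} (x : M.obj X) :
    (liftHom R φ).app X (sT.theta x) = φ.app X x := by
  show R.tr (gid G _) (R.nm (gid G _) (φ.app _ x)) = _
  rw [R.tr_id, R.nm_id]

theorem STambHom.eq_of_theta {F F' : STambHom (freeSemiTambara M) R}
    (h : ∀ (X : FinGSet G) (x : M.obj X), F.app X (sT.theta x) = F'.app X (sT.theta x))
    (X : FinGSet G) (x : sT M X) : F.app X x = F'.app X x := by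
  induction x using sT.ind with
  | _ i j u =>
    rw [sT.mk_eq]
    have e : ∀ F : STambHom (freeSemiTambara M) R,
        F.app X (sT.tr j (sT.nm i (sT.theta u))) = R.tr j (R.nm i (F.app _ (sT.theta u))) :=
      fun F => (F.app_tr j (sT.nm i (sT.theta u))).trans (congrArg _ (F.app_nm i (sT.theta u)))
    rw [e, e, h]

end Lift

section Polynomial

/-- The difference of `f` in the direction `y`. -/
def delta {A C : Type*} [Add A] [Sub C] (y : A) (f : A → C) : A → C :=
  fun x => f (x + y) - f x

/-- `DegLT k f`: all `k`-fold differences of `f` vanish. -/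
def DegLT {A C : Type*} [AddCommMonoid A] [AddCommGroup C] : ℕ → (A → C) → Prop
  | 0, f => ∀ x, f x = 0
  | k + 1, f => ∀ y, DegLT k (delta y f)

/-- Functions all of whose sufficiently long iterated differences vanish, where the required
length may depend on the directions. -/
inductive IsPoly {A C : Type*} [AddCommMonoid A] [AddCommGroup C] : (A → C) → Prop
  | zero : IsPoly (fun _ => 0)
  | step (f : A → C) : (∀ y, IsPoly (delta y f)) → IsPoly f

variable {A B C C' : Type*} [AddCommMonoid A] [AddCommMonoid B] [AddCommGroup C] [AddCommGroup C']

namespace DegLT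

theorem congr {k : ℕ} {f g : A → C} (hf : DegLT k f) (h : ∀ x, g x = f x) : DegLT k g :=
  funext h ▸ hf

theorem add {k : ℕ} {f g : A → C} (hf : DegLT k f) (hg : DegLT k g) :
    DegLT k (fun x => f x + g x) := by
  induction k generalizing f g with
  | zero => exact fun x => by simp [hf x, hg x]
  | succ k ih =>
    exact fun y => (ih (hf y) (hg y)).congr fun x => by simp only [delta]; abel

theorem comp_left {k : ℕ} (L : C →+ C') {f : A → C} (hf : DegLT k f) :
    DegLT k (fun x => L (f x)) := by
  induction k generalizing f with
  | zero => exact fun x => by simp [hf x]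
  | succ k ih => exact fun y => (ih (hf y)).congr fun x => by simp [delta]

theorem translate {k : ℕ} (a : A) {f : A → C} (hf : DegLT k f) :
    DegLT k (fun x => f (a + x)) := by
  induction k generalizing f with
  | zero => exact fun x => hf _
  | succ k ih => exact fun y => (ih (hf y)).congr fun x => by simp [delta, add_assoc]

theorem pi {k : ℕ} {I : Type*} {f : A → I → C} (hf : ∀ i, DegLT k (fun x => f x i)) :
    DegLT k f := by
  induction k generalizing f with
  | zero => exact fun x => funext fun i => hf i x
  | succ k ih => exact fun y => ih fun i => hf i y

theorem isPoly {k : ℕ} {f : A → C} (hf : DegLT k f) : IsPoly f := by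
  induction k generalizing f with
  | zero => rw [show f = fun _ => 0 from funext hf]; exact .zero
  | succ k ih => exact .step f fun y => ih (hf y)

theorem addMonoidHom (L : A →+ C) : DegLT 2 L := fun y z x => by simp [delta]

theorem comp_right {k : ℕ} (L : B →+ A) {f : A → C} (hf : DegLT k f) :
    DegLT k (fun x => f (L x)) := by
  induction k generalizing f with
  | zero => exact fun x => hf _
  | succ k ih => exact fun y => (ih (hf (L y))).congr fun x => by simp [delta]

end DegLT

namespace IsPoly

theorem congr {f g : A → C} (hf : IsPoly f) (h : ∀ x, g x = f x) : IsPoly g :=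
  funext h ▸ hf

theorem delta {f : A → C} (hf : IsPoly f) (y : A) : IsPoly (delta y f) := by
  cases hf with
  | zero => exact zero.congr fun x => by simp [Tamb.delta]
  | step _ h => exact h y

theorem const (c : C) : IsPoly (fun _ : A => c) :=
  .step _ fun y => zero.congr fun x => by simp [Tamb.delta]

theorem add {f g : A → C} (hf : IsPoly f) (hg : IsPoly g) : IsPoly (fun x => f x + g x) := by
  induction hf generalizing g with
  | zero => exact hg.congr fun x => by simp
  | step f hf ih =>
    induction hg with
    | zero => exact (IsPoly.step f hf).congr fun x => by simp
    | step g hg ih' =>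
      exact .step _ fun y => (ih y (hg y)).congr fun x => by simp only [Tamb.delta]; abel

theorem comp_left (L : C →+ C') {f : A → C} (hf : IsPoly f) : IsPoly (fun x => L (f x)) := by
  induction hf with
  | zero => exact zero.congr fun x => by simp
  | step f hf ih => exact .step _ fun y => (ih y).congr fun x => by simp [Tamb.delta]

theorem sub {f g : A → C} (hf : IsPoly f) (hg : IsPoly g) : IsPoly (fun x => f x - g x) :=
  (hf.add (hg.comp_left (negAddMonoidHom))).congr fun x => by simp [sub_eq_add_neg]

theorem translate (a : A) {f : A → C} (hf : IsPoly f) : IsPoly (fun x => f (x + a)) :=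
  ((hf.delta a).add hf).congr fun x => by simp [Tamb.delta]

end IsPoly

end Polynomial

section Composition

universe u

variable {A B : Type u} [AddCommMonoid A] [AddCommGroup B]

/-- Evaluating a polynomial family of polynomial functions at a polynomial function. -/
theorem IsPoly.eval {f : A → B} (hf : IsPoly f) :
    ∀ {C : Type u} [AddCommGroup C] (k : ℕ) (p : A → B → C), IsPoly p →
      (∀ x, DegLT k (p x)) → IsPoly (fun x => p x (f x)) := by
  induction hf with
  | zero =>
    intro C _ k p hp _
    exact hp.comp_left (Pi.evalAddMonoidHom (fun _ : B => C) 0)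
  | step f hf ihf =>
    intro C _ k
    induction k with
    | zero => exact fun p _ h => IsPoly.zero.congr fun x => h x _
    | succ k ihk =>
      intro p hp hd
      induction hp with
      | zero => exact IsPoly.zero
      | step p hp ihp =>
        refine .step _ fun y => ?_
        have h1 := ihp y fun x => ((hd (x + y)).add ((hd x).comp_left negAddMonoidHom)).congr
          fun b => sub_eq_add_neg _ _
        have h2 : IsPoly (fun x b => p (x + y) (b + Tamb.delta y f x)) := by
          refine ihf y (C := B → C) (k + 1) (fun x u b => p (x + y) (b + u)) ?_ ?_
          · exact ((IsPoly.step p hp).translate y).comp_left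
              { toFun := fun q u b => q (b + u)
                map_zero' := rfl
                map_add' := fun _ _ => rfl }
          · exact fun x => DegLT.pi fun b => (hd (x + y)).translate b
        have h3 := h2.sub ((IsPoly.step p hp).translate y)
        have h4 := ihk _ h3 fun x => hd (x + y) (Tamb.delta y f x)
        refine (h4.add h1).congr fun x => ?_
        simp [Tamb.delta]

theorem IsPoly.comp {C : Type u} [AddCommGroup C] {k : ℕ} {g : B → C} (hg : DegLT k g) {f : A → B}
    (hf : IsPoly f) : IsPoly (fun x => g (f x)) :=
  hf.eval k (fun _ => g) (IsPoly.const g) fun _ => hg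

end Composition

section Extension

variable {A K C : Type*} [AddCommMonoid A] [AddCommGroup K] [AddCommGroup C]

/-- `ι : A → K` is a group completion. -/
structure IsGroupCompletion (ι : A →+ K) : Prop where
  exists_sub : ∀ z, ∃ a b, z = ι a - ι b
  eq_iff : ∀ a b, ι a = ι b ↔ ∃ c, a + c = b + c

namespace IsGroupCompletion

variable {ι : A →+ K}

theorem eq_zero_of_isPoly (hι : IsGroupCompletion ι) {f : K → C} (hf : IsPoly f)
    (h : ∀ a, f (ι a) = 0) (z : K) : f z = 0 := by
  induction hf generalizing z with
  | zero => rfl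
  | step f hf ih =>
    obtain ⟨a, b, rfl⟩ := hι.exists_sub z
    have := ih (ι b) (fun a => by simp [delta, h, ← map_add]) (ι a - ι b)
    simpa [delta, h] using this

/-- A polynomial function on the group completion is determined by its restriction. -/
theorem eq_of_isPoly (hι : IsGroupCompletion ι) {f g : K → C} (hf : IsPoly f) (hg : IsPoly g)
    (h : ∀ a, f (ι a) = g (ι a)) (z : K) : f z = g z :=
  sub_eq_zero.1 (hι.eq_zero_of_isPoly (hf.sub hg) (fun a => sub_eq_zero.2 (h a)) z)

/-- Functions of bounded degree extend to the group completion. -/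
theorem exists_extension (hι : IsGroupCompletion ι) {k : ℕ} {φ : A → C} (hφ : DegLT k φ) :
    ∃ φ' : K → C, DegLT k φ' ∧ ∀ a, φ' (ι a) = φ a := by
  induction k generalizing φ with
  | zero => exact ⟨fun _ => 0, fun _ => rfl, fun a => (hφ a).symm⟩
  | succ k ih =>
    choose D hD hDι using fun b => ih (hφ b)
    have cocycle : ∀ b c z, D (b + c) z = D b (z + ι c) + D c z := by
      intro b c
      have h1 : IsPoly fun z => D b (z + ι c) := (hD b).isPoly.translate (ι c)
      refine hι.eq_of_isPoly (hD (b + c)).isPoly (h1.add (hD c).isPoly) fun a => ?_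
      rw [hDι, hDι, ← map_add, hDι]
      simp only [delta]
      rw [show a + (b + c) = a + c + b by abel]
      abel
    have hF : ∀ a b c, φ (a + c) - D (b + c) (ι (a + c) - ι (b + c)) =
        φ a - D b (ι a - ι b) := by
      intro a b c
      have h1 := hDι c a
      have h3 := cocycle c b (ι a - ι b)
      rw [add_comm c b, sub_add_cancel, h1] at h3
      rw [map_add, map_add, add_sub_add_right_eq_sub, h3, delta]
      abel
    have key : ∀ z, ∃ w, ∀ a b, z = ι a - ι b → w = φ a - D b (ι a - ι b) := by
      intro z
      obtain ⟨a, b, rfl⟩ := hι.exists_sub z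
      refine ⟨φ a - D b (ι a - ι b), fun a' b' e => ?_⟩
      have e' : ι (a + b') = ι (a' + b) := by
        rw [map_add, map_add]
        rw [sub_eq_sub_iff_add_eq_add] at e
        exact e
      obtain ⟨c, hc⟩ := (hι.eq_iff _ _).1 e'
      have h1 := hF a b (b' + c)
      have h2 := hF a' b' (b + c)
      rw [← add_assoc, hc, show b + (b' + c) = b' + (b + c) by abel, add_assoc] at h1
      rw [← h1, ← h2]
    choose φ' hφ' using key
    have hval : ∀ a, φ' (ι a) = φ a := by
      intro a
      have h1 := hφ' (ι a) (a + 0) (0 + 0) (by simp)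
      have h2 := cocycle 0 0 (ι a)
      rw [map_zero, add_zero, add_zero] at h2
      rw [h1, add_zero, add_zero, map_zero, sub_zero, left_eq_add.1 h2, sub_zero]
    have hdelta : ∀ c z, φ' (z + ι c) - φ' z = D c z := by
      intro c z
      obtain ⟨a, b, rfl⟩ := hι.exists_sub z
      rw [hφ' (ι a - ι b) a b rfl, hφ' _ (a + c) b (by rw [map_add]; abel)]
      have h1 := cocycle b c (ι a - ι b)
      have h2 := cocycle c b (ι a - ι b)
      rw [add_comm c b, h1, sub_add_cancel, hDι c a] at h2
      rw [map_add, add_sub_right_comm, eq_sub_of_add_eq h2]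
      simp only [delta]
      abel
    refine ⟨φ', fun y => ?_, hval⟩
    obtain ⟨c, d, rfl⟩ := hι.exists_sub y
    have h1 := ((hD c).add ((hD d).comp_left negAddMonoidHom)).translate (-ι d)
    refine h1.congr fun z => ?_
    have e1 := hdelta c (-ι d + z)
    have e2 := hdelta d (-ι d + z)
    simp only [delta, negAddMonoidHom_apply, ← e1, ← e2]
    rw [show -ι d + z + ι d = z by abel, show -ι d + z + ι c = z + (ι c - ι d) by abel]
    abel

end IsGroupCompletion

theorem isGroupCompletion_of (A : Type*) [AddCommMonoid A] :
    IsGroupCompletion (Algebra.GrothendieckAddGroup.of : A →+ Algebra.GrothendieckAddGroup A) where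
  exists_sub z := by
    obtain ⟨⟨a, b⟩, h⟩ := (AddLocalization.addMonoidOf (⊤ : AddSubmonoid A)).surj z
    exact ⟨a, b, eq_sub_of_add_eq h⟩
  eq_iff a b := by
    refine ((AddLocalization.addMonoidOf (⊤ : AddSubmonoid A)).eq_iff_exists).trans ?_
    simp [add_comm]

end Extension

/-- The complement of the image of an equivariant map. -/
def complG {X Y : FinGSet G} (l : Hom X Y) : FinGSet G where
  carrier := {y : Y.carrier // ∀ x, l x ≠ y}
  act :=
    { smul := fun a y => ⟨a • y.1, fun x e => y.2 (a⁻¹ • x) (by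
        rw [map_smul, e, inv_smul_smul])⟩
      one_smul := fun y => Subtype.ext (one_smul _ _)
      mul_smul := fun a b y => Subtype.ext (mul_smul _ _ _) }

/-- The inclusion of the complement of the image of an equivariant map. -/
def complHom {X Y : FinGSet G} (l : Hom X Y) : Hom (complG l) Y := ⟨Subtype.val, fun _ _ => rfl⟩

theorem bijective_sumElim_complHom {X Y : FinGSet G} (l : Hom X Y) (hl : Function.Injective l) :
    Function.Bijective (sumElimHom l (complHom l)) := by
  constructor
  · rintro (a | a) (b | b) e
    · exact congrArg _ (hl e)
    · exact (b.2 a e).elim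
    · exact (a.2 b e.symm).elim
    · exact congrArg _ (Subtype.ext e)
  · intro y
    by_cases h : ∃ x, l x = y
    · exact ⟨Sum.inl h.choose, h.choose_spec⟩
    · exact ⟨Sum.inr ⟨y, fun x e => h ⟨x, e⟩⟩, rfl⟩

/-- Off the section picking the first summand everywhere, fewer points of a fiber are
assigned to the first summand. -/
theorem IsDist.card_fiber_lt {A₁ A₂ B A' B' : FinGSet G} {g₁ : Hom A₁ B} {g₂ : Hom A₂ B}
    {f : Hom A' (sumG (sumG A₁ A₁) A₂)} {g' : Hom A' B'} {h : Hom B' B}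
    (D : IsDist (sumMapHom (foldHom A₁) (gid G A₂.carrier)) (sumElimHom g₁ g₂) f g' h)
    {l : Hom B B'} (hl : ∀ b, h (l b) = b)
    (hf : ∀ a, (∃ b, g' a = l b) → f a = Sum.map Sum.inl (fun x => x)
      (sumMapHom (foldHom A₁) (gid G A₂.carrier) (f a)))
    {A'' : FinGSet G} {g'' : Hom A'' (complG l)} {r : Hom A'' A'}
    (H : IsPB g'' r (complHom l) g') {U : FinGSet G} {u : Hom U A''} {d : Hom U A₁}
    (HU : IsPB u d (gcomp f r) (gcomp (inlHom (sumG A₁ A₁) A₂) (inlHom A₁ A₁)))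
    (b : (complG l).carrier) :
    Nat.card {x // g'' (u x) = b} < Nat.card {a // g₁ a = h b.1} := by
  have hfr : ∀ x, f (r (u x)) = Sum.inl (Sum.inl (d x)) := HU.comm
  have hgr : ∀ x, g' (r (u x)) = (g'' (u x)).1 := fun x => (H.comm _).symm
  have hd : ∀ x, g₁ (d x) = h (g'' (u x)).1 := by
    intro x
    have := D.comm (r (u x))
    rw [hfr, hgr] at this
    exact this
  let F : {x // g'' (u x) = b} → {a // g₁ a = h b.1} :=
    fun x => ⟨d x.1, by rw [hd, x.2]⟩
  have hF : Function.Injective F := by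
    rintro ⟨x, hx⟩ ⟨x', hx'⟩ e
    have e' : d x = d x' := congrArg Subtype.val e
    refine Subtype.ext (HU.inj _ _ (H.inj _ _ (hx.trans hx'.symm) (D.inj _ _ ?_ ?_)) e')
    · rw [hfr, hfr, e']
    · rw [hgr, hgr, hx, hx']
  refine lt_of_not_ge fun hle => ?_
  have hsurj := (hF.bijective_of_nat_card_le hle).2
  refine b.2 (h b.1) (D.sec_inj _ _ (hl _) fun a' a ha' ha e => ?_)
  rw [hf a' ⟨_, ha'⟩, e]
  have hW := D.comm a
  rw [ha] at hW
  rcases hfa : f a with (a₁ | a₁) | a₂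
  · rfl
  · rw [hfa] at hW
    obtain ⟨⟨x, hx⟩, hx'⟩ := hsurj ⟨a₁, hW⟩
    have hx'' : d x = a₁ := congrArg Subtype.val hx'
    have : r (u x) = a := by
      refine D.inj _ _ ?_ ?_
      · rw [hfr, hfa, hx'']; rfl
      · rw [hgr, hx, ha]
    rw [← this, hfr] at hfa
    cases hfa
  · rfl

namespace SemiTambara

variable (S : SemiTambara G)

theorem degLT_nm_sumElim {C : Type*} [AddCommGroup C] (k : ℕ) :
    ∀ {A₁ A₂ B : FinGSet G} (g₁ : Hom A₁ B) (g₂ : Hom A₂ B) (c : S.obj A₂) (ι : S.obj B →+ C),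
      (∀ b, Nat.card {a // g₁ a = b} < k) →
      DegLT k (fun x => ι (S.nm (sumElimHom g₁ g₂) (S.pairElt x c))) := by
  induction k with
  | zero =>
    intro A₁ A₂ B g₁ g₂ c ι hk x
    have hB : IsEmpty B.carrier := ⟨fun b => Nat.not_lt_zero _ (hk b)⟩
    dsimp only
    rw [sT.obj_eq_of_isEmpty hB (S.nm _ _) 0, map_zero]
  | succ k ih =>
    intro A₁ A₂ B g₁ g₂ c ι hk y
    obtain ⟨A', B', f, g', h, D⟩ :=
      exists_isDist (sumMapHom (foldHom A₁) (gid G A₂.carrier)) (sumElimHom g₁ g₂)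
    have H₀ : IsPB (gid G (sumG A₁ A₂).carrier) (sumElimHom g₁ g₂) (sumElimHom g₁ g₂)
      (gid G B.carrier) := IsPB.id_left _
    obtain ⟨l, hl, hl'⟩ := D.lift H₀ (sumMapHom (inlHom A₁ A₁) (gid G A₂.carrier))
      (by rintro (a | a) <;> rfl)
    replace hl : ∀ b, h (l b) = b := hl
    obtain ⟨q, hq, hq'⟩ := IsPB.lift (f := sumElimHom g₁ g₂) (g := h)
      (p := gcomp (sumMapHom (foldHom A₁) (gid G A₂.carrier)) f) (q := g') D.isPB
      (gid G (sumG A₁ A₂).carrier) (gcomp l (sumElimHom g₁ g₂)) (fun a => (hl _).symm)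
    have Hq : IsPB (sumElimHom g₁ g₂) q l g' :=
      { comm := fun a => (hq' a).symm
        ex := fun b a e => by
          have e' : sumElimHom g₁ g₂ (sumMapHom (foldHom A₁) (gid G A₂.carrier) (f a)) = b := by
            rw [D.comm, ← e, hl]
          refine ⟨_, e', D.inj _ _ (hq _) ?_⟩
          rw [hq', gcomp_apply, e', e]
        inj := fun a a' _ e => by
          have := hq a
          rw [e, hq a'] at this
          exact this.symm }
    have hfq : ∀ n, f (q n) = sumMapHom (inlHom A₁ A₁) (gid G A₂.carrier) n :=
      fun n => hl' _ _ (hq' n) (hq n)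
    obtain ⟨A'', g'', r, HA⟩ := exists_isPB (complHom l) g'
    obtain ⟨U₁, u₁, d₁, HU₁⟩ := exists_isPB (gcomp f r)
      (gcomp (inlHom (sumG A₁ A₁) A₂) (inlHom A₁ A₁))
    obtain ⟨U₂, u₂, d₂, HU₂⟩ := exists_isPB (gcomp f r)
      (sumElimHom (gcomp (inlHom (sumG A₁ A₁) A₂) (inrHom A₁ A₁)) (inrHom (sumG A₁ A₁) A₂))
    have hu := IsPB.bijective_sumElim (SemiMackey.bijective_assoc A₁ A₁ A₂) HU₁ HU₂
    have hlinj : Function.Injective l := fun a b e => by rw [← hl a, ← hl b, e]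
    have key := (ih (gcomp g'' u₁) (gcomp g'' u₂) (S.res d₂ (S.pairElt y c))
      (ι.comp (S.trHom (gcomp h (complHom l)))) fun b => by
        refine lt_of_lt_of_le (D.card_fiber_lt hl ?_ HA HU₁ b) (Nat.lt_succ_iff.1 (hk _))
        rintro a ⟨b, hb⟩
        refine hl' a _ ?_ rfl
        rw [hb, D.comm, hb, hl]).comp_right (S.resHom d₁)
    refine key.congr fun x => ?_
    have hz : S.tr (sumMapHom (foldHom A₁) (gid G A₂.carrier)) (S.pairElt (S.pairElt x y) c) =
        S.pairElt (x + y) c := by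
      rw [S.tr_sumMap, S.tr_id]; rfl
    rw [delta, ← hz, S.nm_tr D, S.tr_split l (complHom l)
      (bijective_sumElim_complHom l hlinj), S.res_nm Hq, S.res_nm HA, S.res_comp, S.res_comp,
      show gcomp f q = _ from Hom.ext hfq, S.res_sumMap, S.res_inl_pairElt, S.res_id,
      S.tr_eq_self hl, S.add_eq, map_add, add_sub_cancel_left]
    have e₁ : gcomp (gcomp f r) u₁ =
      gcomp (gcomp (inlHom (sumG A₁ A₁) A₂) (inlHom A₁ A₁)) d₁ := Hom.ext HU₁.comm
    have e₂ : gcomp (gcomp f r) u₂ =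
      gcomp (sumElimHom (gcomp (inlHom (sumG A₁ A₁) A₂) (inrHom A₁ A₁))
        (inrHom (sumG A₁ A₁) A₂)) d₂ := Hom.ext HU₂.comm
    have e₃ : gcomp g'' (sumElimHom u₁ u₂) = sumElimHom (gcomp g'' u₁) (gcomp g'' u₂) :=
      Hom.ext fun a => by cases a <;> rfl
    rw [← S.nm_gcomp_res hu _ g'', S.res_sumElim, S.res_comp, S.res_comp, e₁, e₂, e₃,
      ← S.res_comp, ← S.res_comp, ← S.res_comp, S.res_inl_pairElt, S.res_inl_pairElt,
      S.res_sumElim, ← S.res_comp, S.res_inl_pairElt, S.res_inr_pairElt, S.res_inr_pairElt]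
    rfl

theorem degLT_nm {A B : FinGSet G} (g : Hom A B) {C : Type*} [AddCommGroup C]
    (ι : S.obj B →+ C) : DegLT (Nat.card A.carrier + 1) (fun x => ι (S.nm g x)) := by
  refine (S.degLT_nm_sumElim _ g (initHom B) (S.nonempty _).some ι fun b =>
    Nat.lt_succ_of_le (Nat.card_le_card_of_injective _ Subtype.val_injective)).congr fun x => ?_
  have e : gcomp g (sumElimHom (gid G A.carrier) (initHom A)) = sumElimHom g (initHom B) :=
    Hom.ext fun a => by
      rcases a with a | a
      · rfl
      · exact Empty.elim a
  rw [← S.nm_gcomp_res (SemiMackey.bijective_gid_init A), S.res_sumElim, S.res_id, e,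
    S.empty_eq (S.res (initHom A) x)]

end SemiTambara

open Algebra (GrothendieckAddGroup)

namespace GroupCompletion

variable (S : SemiTambara G)

/-- The levels of the additive completion of a semi-Tambara functor. -/
abbrev Obj (X : FinGSet G) : Type 1 := GrothendieckAddGroup (S.obj X)

variable {S}

theorem lift_of {A K : Type*} [AddCommMonoid A] [AddCommGroup K] (f : A →+ K) (a : A) :
    GrothendieckAddGroup.lift f (GrothendieckAddGroup.of a) = f a :=
  DFunLike.congr_fun (GrothendieckAddGroup.lift.symm_apply_apply f) a

/-- The completion map. -/
noncomputable abbrev of {X : FinGSet G} : S.obj X →+ Obj S X := GrothendieckAddGroup.of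

/-- The additive map induced on completions. -/
noncomputable def map {X Y : FinGSet G} (φ : S.obj X →+ S.obj Y) : Obj S X →+ Obj S Y :=
  GrothendieckAddGroup.lift (of.comp φ)

theorem map_of {X Y : FinGSet G} (φ : S.obj X →+ S.obj Y) (x : S.obj X) :
    map φ (of x) = of (φ x) := lift_of _ _

theorem hom_ext {X : FinGSet G} {K : Type*} [AddCommGroup K] (φ ψ : Obj S X →+ K)
    (h : ∀ a : S.obj X, φ (of a) = ψ (of a)) (z : Obj S X) : φ z = ψ z :=
  (isGroupCompletion_of _).eq_of_isPoly (DegLT.addMonoidHom φ).isPoly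
    (DegLT.addMonoidHom ψ).isPoly h z

theorem exists_nm {X Y : FinGSet G} (f : Hom X Y) :
    ∃ n : Obj S X → Obj S Y, DegLT (Nat.card X.carrier + 1) n ∧
      ∀ a, n (of a) = of (S.nm f a) :=
  (isGroupCompletion_of _).exists_extension (S.degLT_nm f of)

/-- The polynomial extension of a norm to the completions. -/
noncomputable def nm {X Y : FinGSet G} (f : Hom X Y) : Obj S X → Obj S Y :=
  (exists_nm f).choose

theorem degLT_nm {X Y : FinGSet G} (f : Hom X Y) :
    DegLT (Nat.card X.carrier + 1) (nm (S := S) f) := (exists_nm f).choose_spec.1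

theorem nm_of {X Y : FinGSet G} (f : Hom X Y) (a : S.obj X) : nm f (of a) = of (S.nm f a) :=
  (exists_nm f).choose_spec.2 a

/-- Transfers on the completion. -/
noncomputable def tr {X Y : FinGSet G} (f : Hom X Y) : Obj S X →+ Obj S Y := map (S.trHom f)

/-- Restrictions on the completion. -/
noncomputable def res {X Y : FinGSet G} (f : Hom X Y) : Obj S Y →+ Obj S X := map (S.resHom f)

theorem tr_of {X Y : FinGSet G} (f : Hom X Y) (a : S.obj X) : tr f (of a) = of (S.tr f a) :=
  map_of _ _

theorem res_of {X Y : FinGSet G} (f : Hom X Y) (a : S.obj Y) : res f (of a) = of (S.res f a) :=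
  map_of _ _

theorem poly_ext {X : FinGSet G} {K : Type*} [AddCommGroup K] {k l : ℕ} {f g : Obj S X → K}
    (hf : DegLT k f) (hg : DegLT l g) (h : ∀ a : S.obj X, f (of a) = g (of a)) (z : Obj S X) :
    f z = g z :=
  (isGroupCompletion_of _).eq_of_isPoly hf.isPoly hg.isPoly h z

theorem sum_decomp {X Y : FinGSet G} (z : Obj S (sumG X Y)) :
    tr (inlHom X Y) (res (inlHom X Y) z) + tr (inrHom X Y) (res (inrHom X Y) z) = z :=
  hom_ext ((tr (inlHom X Y)).comp (res (inlHom X Y)) + (tr (inrHom X Y)).comp (res (inrHom X Y)))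
    (AddMonoidHom.id _) (fun a => by
      simp only [AddMonoidHom.add_apply, AddMonoidHom.comp_apply, AddMonoidHom.id_apply]
      rw [res_of, res_of, tr_of, tr_of, ← map_add, S.sum_decomp]) z

theorem res_inl_tr_inl {X Y : FinGSet G} (x : Obj S X) :
    res (inlHom X Y) (tr (inlHom X Y) x) = x :=
  hom_ext ((res (inlHom X Y)).comp (tr (inlHom X Y))) (AddMonoidHom.id _) (fun a => by
    simp only [AddMonoidHom.comp_apply, AddMonoidHom.id_apply]
    rw [tr_of, res_of, S.res_tr_of_injective _ (inlHom_injective X Y)]) x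

theorem res_inr_tr_inr {X Y : FinGSet G} (x : Obj S Y) :
    res (inrHom X Y) (tr (inrHom X Y) x) = x :=
  hom_ext ((res (inrHom X Y)).comp (tr (inrHom X Y))) (AddMonoidHom.id _) (fun a => by
    simp only [AddMonoidHom.comp_apply, AddMonoidHom.id_apply]
    rw [tr_of, res_of, S.res_tr_of_injective _ (inrHom_injective X Y)]) x

theorem res_inl_tr_inr {X Y : FinGSet G} (x : Obj S Y) :
    res (inlHom X Y) (tr (inrHom X Y) x) = 0 :=
  hom_ext ((res (inlHom X Y)).comp (tr (inrHom X Y))) 0 (fun a => by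
    simp only [AddMonoidHom.comp_apply, AddMonoidHom.zero_apply]
    rw [tr_of, res_of, S.res_inl_tr_inr, map_zero]) x

theorem res_inr_tr_inl {X Y : FinGSet G} (x : Obj S X) :
    res (inrHom X Y) (tr (inlHom X Y) x) = 0 :=
  hom_ext ((res (inrHom X Y)).comp (tr (inlHom X Y))) 0 (fun a => by
    simp only [AddMonoidHom.comp_apply, AddMonoidHom.zero_apply]
    rw [tr_of, res_of, S.res_inr_tr_inl, map_zero]) x

theorem tr_id {X : FinGSet G} (x : Obj S X) : tr (gid G X.carrier) x = x :=
  hom_ext (tr (gid G X.carrier)) (AddMonoidHom.id _) (fun a => by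
    rw [tr_of, S.tr_id, AddMonoidHom.id_apply]) x

theorem tr_comp {X Y Z : FinGSet G} (i : Hom X Y) (j : Hom Y Z) (x : Obj S X) :
    tr j (tr i x) = tr (gcomp j i) x :=
  hom_ext ((tr j).comp (tr i)) (tr (gcomp j i)) (fun a => by
    rw [AddMonoidHom.comp_apply, tr_of, tr_of, tr_of, S.tr_comp]) x

theorem res_tr {P X Y Z : FinGSet G} {p : Hom P X} {q : Hom P Y} {f : Hom X Z} {g : Hom Y Z}
    (H : IsPB p q f g) (y : Obj S Y) : res f (tr g y) = tr p (res q y) :=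
  hom_ext ((res f).comp (tr g)) ((tr p).comp (res q)) (fun a => by
    rw [AddMonoidHom.comp_apply, AddMonoidHom.comp_apply, tr_of, res_of, res_of, tr_of,
      S.res_tr H]) y

theorem res_nm {P X Y Z : FinGSet G} {p : Hom P X} {q : Hom P Y} {f : Hom X Z} {g : Hom Y Z}
    (H : IsPB p q f g) (y : Obj S Y) : res f (nm g y) = nm p (res q y) :=
  poly_ext ((degLT_nm g).comp_left (res f)) ((degLT_nm p).comp_right (res q)) (fun a => by
    rw [nm_of, res_of, res_of, nm_of, S.res_nm H]) y

/-- The semi-Tambara functor of group completions. -/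
noncomputable def semiTambara (S : SemiTambara G) : SemiTambara G where
  obj := Obj S
  nonempty _ := ⟨0⟩
  res f := res f
  tr f := tr f
  nm f := nm f
  res_id {X} := hom_ext (res (gid G X.carrier)) (AddMonoidHom.id _) fun a => by
    rw [res_of, S.res_id, AddMonoidHom.id_apply]
  res_comp i j := hom_ext ((res i).comp (res j)) (res (gcomp j i)) fun a => by
    rw [AddMonoidHom.comp_apply, res_of, res_of, res_of, S.res_comp]
  tr_id := tr_id
  tr_comp := tr_comp
  mackey j i := res_tr (isPB_canonical j i)
  sum_bij X Y := by
    constructor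
    · intro z w e
      have e₁ : res (inlHom X Y) z = res (inlHom X Y) w := congrArg Prod.fst e
      have e₂ : res (inrHom X Y) z = res (inrHom X Y) w := congrArg Prod.snd e
      rw [← sum_decomp z, e₁, e₂, sum_decomp]
    · rintro ⟨x, y⟩
      refine ⟨tr (inlHom X Y) x + tr (inrHom X Y) y, Prod.ext ?_ ?_⟩
      · exact (map_add _ _ _).trans (by rw [res_inl_tr_inl, res_inl_tr_inr, add_zero])
      · exact (map_add _ _ _).trans (by rw [res_inr_tr_inl, res_inr_tr_inr, zero_add])
  empty_subsingleton := by
    have h : ∀ z : Obj S (emptyG G), z = 0 := fun z => by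
      obtain ⟨a, b, rfl⟩ := (isGroupCompletion_of _).exists_sub z
      rw [S.empty_eq a b, sub_self]
    exact ⟨fun a b => (h a).trans (h b).symm⟩
  nm_id {X} := poly_ext (g := fun x => x) (degLT_nm _)
    (DegLT.addMonoidHom (AddMonoidHom.id (Obj S X))) fun a => by rw [nm_of, S.nm_id]
  nm_comp i j := (isGroupCompletion_of _).eq_of_isPoly ((degLT_nm i).isPoly.comp (degLT_nm j))
    (degLT_nm _).isPoly fun a => by
      rw [nm_of, nm_of, nm_of, S.nm_comp]
  nm_res j i := res_nm (isPB_canonical j i)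
  distrib i j f g h D := poly_ext ((degLT_nm j).comp_right (tr i))
    (((degLT_nm g).comp_left (tr h)).comp_right (res f)) fun a => by
      rw [tr_of, nm_of, res_of, nm_of, tr_of, S.distrib i j f g h D]

theorem add_eq {X : FinGSet G} (x y : Obj S X) :
    (semiTambara S).add (X := X) x y = x + y := by
  have h : (semiTambara S).pairElt (X := X) (Y := X) x y =
      (tr (inlHom X X) x + tr (inrHom X X) y : Obj S (sumG X X)) := by
    apply (semiTambara S).ext_sum
    · refine ((semiTambara S).res_inl_pairElt _ _).trans ?_
      refine Eq.symm ((map_add (res (inlHom X X)) _ _).trans ?_)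
      rw [res_inl_tr_inl, res_inl_tr_inr, add_zero]
    · refine ((semiTambara S).res_inr_pairElt _ _).trans ?_
      refine Eq.symm ((map_add (res (inrHom X X)) _ _).trans ?_)
      rw [res_inr_tr_inl, res_inr_tr_inr, zero_add]
  refine (congrArg (tr (foldHom X)) h).trans ((map_add (tr (foldHom X)) _ _).trans ?_)
  rw [tr_comp, tr_comp]
  exact congrArg₂ (· + ·) (tr_id x) (tr_id y)

theorem exists_add_eq_zero {X : FinGSet G} (x : Obj S X) :
    ∃ y : Obj S X, (semiTambara S).add (X := X) x y = (0 : Obj S X) :=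
  ⟨-x, (add_eq _ _).trans (add_neg_cancel x)⟩

theorem zero_eq (X : FinGSet G) : (semiTambara S).zero X = (0 : Obj S X) :=
  (congrArg (tr (initHom X)) ((semiTambara S).empty_eq _ (0 : Obj S (emptyG G)))).trans
    (map_zero (tr (initHom X)))

end GroupCompletion

/-- The additive completion of a semi-Tambara functor. -/
noncomputable def groupCompletion (S : SemiTambara G) : Tambara G where
  toSemiTambara := GroupCompletion.semiTambara S
  hasNeg X x := GroupCompletion.zero_eq (S := S) X ▸ GroupCompletion.exists_add_eq_zero x

/-- The completion map as a map of semi-Tambara functors. -/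
noncomputable def completionHom (S : SemiTambara G) :
    STambHom S (groupCompletion S).toSemiTambara where
  app _ x := GroupCompletion.of x
  app_res f y := (GroupCompletion.res_of f y).symm
  app_tr f x := (GroupCompletion.tr_of f x).symm
  app_nm f x := (GroupCompletion.nm_of f x).symm

theorem completionHom_eq_iff {S : SemiTambara G} {X : FinGSet G} (a b : S.obj X) :
    (completionHom S).app X a = (completionHom S).app X b ↔ ∃ c, S.add a c = S.add b c :=
  (isGroupCompletion_of _).eq_iff a b

theorem exists_add_completionHom {S : SemiTambara G} {X : FinGSet G}
    (z : (groupCompletion S).obj X) : ∃ a b : S.obj X,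
      (groupCompletion S).add z ((completionHom S).app X b) = (completionHom S).app X a := by
  obtain ⟨a, b, e⟩ := (isGroupCompletion_of (S.obj X)).exists_sub z
  exact ⟨a, b, (GroupCompletion.add_eq _ _).trans (eq_sub_iff_add_eq.1 e)⟩

section Universal

variable {S : SemiTambara G} (R : Tambara G)

/-- The levels of a Tambara functor are abelian groups. -/
noncomputable abbrev Tambara.addCommGroup (X : FinGSet G) : AddCommGroup (R.obj X) :=
  letI : Neg (R.obj X) := ⟨fun x => (R.hasNeg X x).choose⟩
  { (inferInstance : AddCommMonoid (R.obj X)) with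
    zsmul := zsmulRec
    neg_add_cancel := fun x => (add_comm _ _).trans (R.hasNeg X x).choose_spec }

theorem Tambara.add_right_cancel {X : FinGSet G} {x y z : R.obj X} (h : R.add x z = R.add y z) :
    x = y := by
  let _ := R.addCommGroup X
  exact _root_.add_right_cancel (b := z) h

/-- The extension of a map of semi-Tambara functors to the additive completion. -/
noncomputable def completionLift (Φ : STambHom S R.toSemiTambara) :
    STambHom (groupCompletion S).toSemiTambara R.toSemiTambara :=
  letI := R.addCommGroup
  let F : ∀ X, GroupCompletion.Obj S X →+ R.obj X := fun X =>
    GrothendieckAddGroup.lift (Φ.appHom X)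
  have hF : ∀ X (a : S.obj X), F X (GroupCompletion.of a) = Φ.app X a :=
    fun X a => GroupCompletion.lift_of _ _
  { app := fun X => F X
    app_res := fun {X Y} f => GroupCompletion.hom_ext ((F X).comp (GroupCompletion.res f))
      ((R.resHom f).comp (F Y)) fun a => by
        refine (congrArg (F X) (GroupCompletion.res_of f a)).trans ?_
        refine (hF _ _).trans ((Φ.app_res f a).trans ?_)
        exact congrArg (R.res f) (hF _ _).symm
    app_tr := fun {X Y} f => GroupCompletion.hom_ext ((F Y).comp (GroupCompletion.tr f))
      ((R.trHom f).comp (F X)) fun a => by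
        refine (congrArg (F Y) (GroupCompletion.tr_of f a)).trans ?_
        refine (hF _ _).trans ((Φ.app_tr f a).trans ?_)
        exact congrArg (R.tr f) (hF _ _).symm
    app_nm := fun {X Y} f => GroupCompletion.poly_ext
      ((GroupCompletion.degLT_nm f).comp_left (F Y))
      ((R.degLT_nm f (AddMonoidHom.id _)).comp_right (F X)) fun a => by
        refine (congrArg (F Y) (GroupCompletion.nm_of f a)).trans ?_
        refine (hF _ _).trans ((Φ.app_nm f a).trans ?_)
        exact congrArg (R.nm f) (hF _ _).symm }

theorem completionLift_app (Φ : STambHom S R.toSemiTambara) {X : FinGSet G} (a : S.obj X) :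
    (completionLift R Φ).app X ((completionHom S).app X a) = Φ.app X a :=
  letI := R.addCommGroup
  GroupCompletion.lift_of _ _

variable {R}

theorem eq_of_completionHom {F F' : STambHom (groupCompletion S).toSemiTambara R.toSemiTambara}
    (h : ∀ (X : FinGSet G) (a : S.obj X),
      F.app X ((completionHom S).app X a) = F'.app X ((completionHom S).app X a)) : F = F' := by
  have key : ∀ X z, F.app X z = F'.app X z := by
    intro X z
    obtain ⟨a, b, e⟩ := exists_add_completionHom z
    apply R.add_right_cancel (z := F.app X ((completionHom S).app X b))
    refine ((F.appHom X).map_add z _).symm.trans ((congrArg (F.app X) e).trans ((h X a).trans ?_))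
    refine (congrArg (F'.app X) e).symm.trans (((F'.appHom X).map_add z _).trans ?_)
    exact congrArg (R.add _) (h X b).symm
  obtain ⟨⟨f, _, _⟩, _⟩ := F
  obtain ⟨⟨f', _, _⟩, _⟩ := F'
  obtain rfl : f = f' := funext fun X => funext fun z => key X z
  rfl

end Universal

/-- Precomposition of a map of semi-Tambara functors with the completion map. -/
noncomputable def STambHom.compCompletionHom {S : SemiTambara G} {R : SemiTambara G}
    (F : STambHom (groupCompletion S).toSemiTambara R) : STambHom S R where
  app X x := F.app X ((completionHom S).app X x)
  app_res f y := (congrArg _ ((completionHom S).app_res f y)).trans (F.app_res f _)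
  app_tr f x := (congrArg _ ((completionHom S).app_tr f x)).trans (F.app_tr f _)
  app_nm f x := (congrArg _ ((completionHom S).app_nm f x)).trans (F.app_nm f _)

namespace Tamb

variable {G : Type} [Group G]

/-- `T(M)`, the levelwise additive (Grothendieck group) completion of
`sT(M)`, is a Tambara functor, and together with `θ_M : M → T(M)` it is the free Tambara
functor on the Mackey functor `M`: there is a Tambara functor `T` with a map
`c : sT(M) → T` which is a levelwise group completion compatible with all the structure
maps, such that every map of Mackey functors `M → R` to a Tambara functor `R` factors
uniquely through `θ_M` via a map of Tambara functors. -/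
theorem statement7 [Finite G] (M : Mackey G) :
    ∃ (T : Tambara G) (c : ∀ X : FinGSet G, PreT M.toSemiMackey X → T.obj X),
      (∀ (X : FinGSet G) (a b : PreT M.toSemiMackey X),
        Quot.mk (STRel M.toSemiMackey X) a = Quot.mk (STRel M.toSemiMackey X) b →
          c X a = c X b) ∧
      (∀ {X Y : FinGSet G} (f : X.carrier →[G] Y.carrier) (a : PreT M.toSemiMackey X),
        c Y (trPre M.toSemiMackey f a) = T.tr f (c X a)) ∧
      (∀ {X Y : FinGSet G} (f : Y.carrier →[G] X.carrier) (a : PreT M.toSemiMackey X),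
        c Y (resPre M.toSemiMackey f a) = T.res f (c X a)) ∧
      (∀ {X Y : FinGSet G} (f : X.carrier →[G] Y.carrier) (a : PreT M.toSemiMackey X),
        c Y (normPre M.toSemiMackey f a) = T.nm f (c X a)) ∧
      (∀ (X : FinGSet G) (a b : PreT M.toSemiMackey X),
        c X (addPre M.toSemiMackey a b) = T.toSemiMackey.add (c X a) (c X b)) ∧
      (∀ (X : FinGSet G) (t : T.obj X), ∃ a b : PreT M.toSemiMackey X,
        T.toSemiMackey.add t (c X b) = c X a) ∧
      (∀ (X : FinGSet G) (a b : PreT M.toSemiMackey X),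
        c X a = c X b ↔ ∃ k : PreT M.toSemiMackey X,
          Quot.mk (STRel M.toSemiMackey X) (addPre M.toSemiMackey a k) =
            Quot.mk (STRel M.toSemiMackey X) (addPre M.toSemiMackey b k)) ∧
      (∀ (R : Tambara G) (φ : SMackHom M.toSemiMackey R.toSemiMackey),
        ∃! F : STambHom T.toSemiTambara R.toSemiTambara,
          ∀ (X : FinGSet G) (x : M.obj X),
            F.app X (c X (thetaPre M.toSemiMackey X x)) = φ.app X x) := by
  let c : ∀ X : FinGSet G, PreT M.toSemiMackey X →
      (groupCompletion (freeSemiTambara M.toSemiMackey)).obj X := fun X a =>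
    (completionHom (freeSemiTambara M.toSemiMackey)).app X (Quot.mk _ a)
  have hadd : ∀ (X : FinGSet G) (a b : PreT M.toSemiMackey X),
      c X (addPre M.toSemiMackey a b) =
        (groupCompletion (freeSemiTambara M.toSemiMackey)).add (c X a) (c X b) := fun X a b =>
    (congrArg _ (sT.mk_addPre a b)).trans
      (((completionHom (freeSemiTambara M.toSemiMackey)).appHom X).map_add _ _)
  refine ⟨groupCompletion (freeSemiTambara M.toSemiMackey), c,
    fun X a b h => congrArg ((completionHom (freeSemiTambara M.toSemiMackey)).app X) h,
    fun f a => (completionHom (freeSemiTambara M.toSemiMackey)).app_tr f (Quot.mk _ a),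
    fun f a => (completionHom (freeSemiTambara M.toSemiMackey)).app_res f (Quot.mk _ a),
    fun f a => (completionHom (freeSemiTambara M.toSemiMackey)).app_nm f (Quot.mk _ a),
    hadd, fun X t => ?_, fun X a b => ?_, fun R φ => ?_⟩
  · obtain ⟨a, b, h⟩ := exists_add_completionHom t
    induction a using Quot.ind with
    | _ a =>
      induction b using Quot.ind with
      | _ b => exact ⟨a, b, h⟩
  · refine (completionHom_eq_iff _ _).trans ⟨?_, ?_⟩
    · rintro ⟨k, hk⟩
      induction k using Quot.ind with
      | _ k => exact ⟨k, (sT.mk_addPre a k).trans (hk.trans (sT.mk_addPre b k).symm)⟩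
    · rintro ⟨k, hk⟩
      exact ⟨Quot.mk _ k, (sT.mk_addPre a k).symm.trans (hk.trans (sT.mk_addPre b k))⟩
  · refine ⟨completionLift R (liftHom R.toSemiTambara φ), fun X x => ?_, fun F hF => ?_⟩
    · exact (completionLift_app R _ _).trans (liftHom_theta R.toSemiTambara φ x)
    · refine eq_of_completionHom fun X a => ?_
      refine (STambHom.eq_of_theta R.toSemiTambara (F := F.compCompletionHom)
        (F' := liftHom R.toSemiTambara φ) (fun Y x => ?_) X a).trans
        (completionLift_app R _ a).symm
      exact (hF Y x).trans (liftHom_theta R.toSemiTambara φ x).symm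

end Tamb
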